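/- arXiv:1603.06392 — 15 statements merged into one kernel-verified Lean document; each statement's English description precedes it below -/
import Mathlib

section
/- Let (X,d) be a metric space and μ a Borel measure on X that is finite on balls. Assume there exists a constant K ≥ 1 such that for every x ∈ X and every r > 0, μ(Blu(x,r,r)) ≤ K·μ(B(x,r)). Then for every finite collection of balls B(x₁,r₁), …, B(x_n,r_n) there exists a pairwise disjoint subcollection B(x_{i₁},r_{i₁}), …, B(x_{i_m},r_{i_m}) such that μ(⋃_{i=1}^n B(x_i,r_i)) ≤ K·μ(⋃_{j=1}^m B(x_{i_j},r_{i_j})). -/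
open MeasureTheory Metric ENNReal

/-- The uncentered `s`-blossom `Blu(x, r, s)` of the open ball `B(x, r)`:
the union, over all points `z` of `B(x, r)`, of all balls `B(y, s)` containing `z`. -/
def Blu {X : Type*} [PseudoMetricSpace X] (x : X) (r s : ℝ) : Set X :=
  ⋃ z ∈ Metric.ball x r, ⋃ (y : X) (_ : z ∈ Metric.ball y s), Metric.ball y s

theorem greedy_aux {X : Type*} [MetricSpace X] {n : ℕ} (x : Fin n → X) (r : Fin n → ℝ)
    (hr : ∀ i, 0 < r i) (s : Finset (Fin n)) :
    ∃ t : Finset (Fin n), t ⊆ s ∧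
      ((t : Set (Fin n)).Pairwise fun i j =>
        Disjoint (Metric.ball (x i) (r i)) (Metric.ball (x j) (r j))) ∧
      ∀ j ∈ s, ∃ i ∈ t, r j ≤ r i ∧
        ¬ Disjoint (Metric.ball (x j) (r j)) (Metric.ball (x i) (r i)) := by
  classical
  induction s using Finset.strongInduction with
  | H s ih =>
    rcases s.eq_empty_or_nonempty with rfl | hs
    · exact ⟨∅, by simp, by simp, by simp⟩
    obtain ⟨i, his, hi⟩ := Finset.exists_max_image s r hs
    have hself : ¬ Disjoint (Metric.ball (x i) (r i)) (Metric.ball (x i) (r i)) := by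
      rw [Set.not_disjoint_iff]
      exact ⟨x i, Metric.mem_ball_self (hr i), Metric.mem_ball_self (hr i)⟩
    obtain ⟨t, hts, hd, hc⟩ := ih (s.filter fun j =>
        Disjoint (Metric.ball (x j) (r j)) (Metric.ball (x i) (r i)))
      (Finset.filter_ssubset.2 ⟨i, his, hself⟩)
    refine ⟨insert i t, ?_, ?_, ?_⟩
    · intro j hj
      rcases Finset.mem_insert.1 hj with rfl | hj
      · exact his
      · exact (Finset.mem_filter.1 (hts hj)).1
    · rw [Finset.coe_insert]
      refine hd.insert fun j hj _ => ?_
      have := (Finset.mem_filter.1 (hts hj)).2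
      exact ⟨this.symm, this⟩
    · intro j hj
      by_cases h : Disjoint (Metric.ball (x j) (r j)) (Metric.ball (x i) (r i))
      · obtain ⟨k, hk, hk'⟩ := hc j (Finset.mem_filter.2 ⟨hj, h⟩)
        exact ⟨k, Finset.mem_insert_of_mem hk, hk'⟩
      · exact ⟨i, Finset.mem_insert_self _ _, hi j hj, h⟩

/-- **Vitali covering lemma** for measures with boundedly blossoming balls. -/
theorem vitali_covering_of_bounded_blossoms
    {X : Type*} [MetricSpace X] [MeasurableSpace X] [BorelSpace X]
    (μ : Measure X) (hfin : ∀ (x : X) (r : ℝ), μ (Metric.ball x r) < ⊤)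
    (K : ℝ) (hK : 1 ≤ K)
    (hblossom : ∀ (x : X) (r : ℝ), 0 < r →
      μ (Blu x r r) ≤ ENNReal.ofReal K * μ (Metric.ball x r))
    (n : ℕ) (x : Fin n → X) (r : Fin n → ℝ) (hr : ∀ i, 0 < r i) :
    ∃ t : Finset (Fin n),
      ((t : Set (Fin n)).Pairwise fun i j =>
        Disjoint (Metric.ball (x i) (r i)) (Metric.ball (x j) (r j))) ∧
      μ (⋃ i, Metric.ball (x i) (r i)) ≤
        ENNReal.ofReal K * μ (⋃ i ∈ t, Metric.ball (x i) (r i)) := by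
  obtain ⟨t, -, hd, hc⟩ := greedy_aux x r hr Finset.univ
  refine ⟨t, hd, ?_⟩
  calc μ (⋃ i, Metric.ball (x i) (r i)) ≤ μ (⋃ i ∈ t, Blu (x i) (r i) (r i)) := by
        refine measure_mono (Set.iUnion_subset fun j y hy => ?_)
        obtain ⟨i, hi, hle, hnd⟩ := hc j (Finset.mem_univ j)
        obtain ⟨z, hzj, hzi⟩ := Set.not_disjoint_iff.1 hnd
        have hsub := Metric.ball_subset_ball (x := x j) hle
        simp only [Blu, Set.mem_iUnion]
        exact ⟨i, hi, z, hzi, x j, hsub hzj, hsub hy⟩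
    _ ≤ ∑ i ∈ t, μ (Blu (x i) (r i) (r i)) := measure_biUnion_finset_le _ _
    _ ≤ ∑ i ∈ t, ENNReal.ofReal K * μ (Metric.ball (x i) (r i)) :=
        Finset.sum_le_sum fun i _ => hblossom _ _ (hr i)
    _ = ENNReal.ofReal K * μ (⋃ i ∈ t, Metric.ball (x i) (r i)) := by
        rw [← Finset.mul_sum, measure_biUnion_finset hd fun i _ => measurableSet_ball]
end

section
/- Let (X,d) be a metric space, μ a Borel measure on X finite on balls, s > 0, and 0 < r < ∞. Suppose the averaging operator A_s is bounded on L^r(μ) with constant c_r, i.e. ∫ (A_s f)^r dμ ≤ c_r^r ∫ f^r dμ for every nonnegative f ∈ L^r(μ) (the integral on the left taken over the set where A_s f is defined). Then for every p with r ≤ p < ∞ and every nonnegative f ∈ L^p(μ), ∫ (A_s f)^p dμ ≤ c_r^r ∫ f^p dμ; that is, A_s is bounded on L^p(μ) with operator norm at most c_r^{r/p}. -/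
open MeasureTheory Metric ENNReal

/-- The averaging operator `A_s` at radius `s` associated to a Borel measure `μ`:
`A_s f (x) = (1 / μ(B(x,s))) ∫_{B(x,s)} f dμ`. -/
noncomputable def avgOp {X : Type*} [PseudoMetricSpace X] [MeasurableSpace X]
    (μ : Measure X) (s : ℝ) (f : X → ℝ≥0∞) (x : X) : ℝ≥0∞ :=
  (∫⁻ y in Metric.ball x s, f y ∂μ) / μ (Metric.ball x s)

/-- If the averaging operator `A_s` is bounded on `L^r(μ)` with constant `c`, then for
every `p ≥ r` it is bounded on `L^p(μ)` with constant `c^{r/p}`, i.e.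
`∫ (A_s f)^p dμ ≤ c^r ∫ f^p dμ` for every nonnegative `f ∈ L^p(μ)`. -/
theorem averaging_Lp_bound_of_Lr_bound
    {X : Type*} [MetricSpace X] [MeasurableSpace X] [BorelSpace X]
    (μ : Measure X) (hfin : ∀ (x : X) (ρ : ℝ), μ (Metric.ball x ρ) < ⊤)
    (s : ℝ) (hs : 0 < s) (r : ℝ) (hr : 0 < r) (c : ℝ) (hc : 0 ≤ c)
    (hbound : ∀ f : X → ℝ≥0∞, Measurable f → (∫⁻ x, f x ^ r ∂μ) < ⊤ →
      (∫⁻ x in {x | 0 < μ (Metric.ball x s)}, (avgOp μ s f x) ^ r ∂μ) ≤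
        ENNReal.ofReal (c ^ r) * ∫⁻ x, f x ^ r ∂μ)
    (p : ℝ) (hrp : r ≤ p)
    (f : X → ℝ≥0∞) (hf : Measurable f) (hfp : (∫⁻ x, f x ^ p ∂μ) < ⊤) :
    (∫⁻ x in {x | 0 < μ (Metric.ball x s)}, (avgOp μ s f x) ^ p ∂μ) ≤
      ENNReal.ofReal (c ^ r) * ∫⁻ x, f x ^ p ∂μ := by
  have hp : 0 < p := hr.trans_le hrp
  have hq1 : 1 ≤ p / r := (one_le_div hr).2 hrp
  have hq0 : 0 < p / r := by positivity
  have e1 : ∀ a : ℝ≥0∞, (a ^ (p / r)) ^ r = a ^ p := by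
    intro a
    rw [← ENNReal.rpow_mul, div_mul_cancel₀ _ hr.ne']
  have key := hbound (fun y => f y ^ (p / r)) (hf.pow_const _) (by simpa only [e1] using hfp)
  simp only [e1] at key
  refine le_trans ?_ key
  -- pointwise Jensen inequality on the ball
  have jensen : ∀ x, avgOp μ s f x ^ p ≤ avgOp μ s (fun y => f y ^ (p / r)) x ^ r := by
    intro x
    rw [← e1]
    refine ENNReal.rpow_le_rpow ?_ hr.le
    by_cases h0 : μ (Metric.ball x s) = 0
    · have : avgOp μ s f x = 0 := by
        simp [avgOp, Measure.restrict_eq_zero.2 h0]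
      rw [this, ENNReal.zero_rpow_of_pos hq0]
      exact zero_le
    · have hP : IsProbabilityMeasure
          ((μ (Metric.ball x s))⁻¹ • μ.restrict (Metric.ball x s)) := by
        constructor
        simp [ENNReal.inv_mul_cancel h0 (hfin x s).ne]
      have h := eLpNorm'_le_eLpNorm'_of_exponent_le (f := f) zero_lt_one hq1
        ((μ (Metric.ball x s))⁻¹ • μ.restrict (Metric.ball x s)) hf.aestronglyMeasurable
      simp only [eLpNorm', enorm_eq_self, ENNReal.rpow_one, div_one, lintegral_smul_measure,
        smul_eq_mul] at h
      have h2 := ENNReal.rpow_le_rpow h hq0.le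
      rw [← ENNReal.rpow_mul, one_div_mul_cancel hq0.ne', ENNReal.rpow_one] at h2
      simpa only [avgOp, div_eq_mul_inv, mul_comm] using h2
  exact lintegral_mono jensen
end

section
/- Let (X,d) be a metric space, μ a Borel measure on X finite on balls, and C ≥ 1. Then μ satisfies a C local comparability condition if and only if for every r > 0 and all pairs of points x, y ∈ X with d(x,y) ≤ r one has μ(B^cl(x,r)) ≤ C·μ(B^cl(y,r)), where B^cl(x,r) := {y : d(x,y) ≤ r} is the closed ball. -/
open MeasureTheory Metric ENNReal

/-- A measure satisfies a `C` local comparability condition (stated with open balls)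
if and only if the analogous condition holds for closed balls. -/
theorem local_comparability_iff_closedBall
    {X : Type*} [MetricSpace X] [MeasurableSpace X] [BorelSpace X]
    (μ : Measure X) (hfin : ∀ (x : X) (ρ : ℝ), μ (Metric.ball x ρ) < ⊤)
    (C : ℝ) (hC : 1 ≤ C) :
    (∀ (r : ℝ), 0 < r → ∀ x y : X, dist x y < r →
        μ (Metric.ball x r) ≤ ENNReal.ofReal C * μ (Metric.ball y r)) ↔
    (∀ (r : ℝ), 0 < r → ∀ x y : X, dist x y ≤ r →
        μ (Metric.closedBall x r) ≤ ENNReal.ofReal C * μ (Metric.closedBall y r)) := by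
  constructor
  · intro h r hr x y hxy
    obtain ⟨u, hu_anti, hu_mem, hu_lim⟩ := exists_seq_strictAnti_tendsto' (lt_add_one r)
    have hInter : Metric.closedBall y r = ⋂ n, Metric.closedBall y (u n) := by
      ext z
      simp only [Set.mem_iInter, Metric.mem_closedBall]
      constructor
      · intro hz n
        exact hz.trans (hu_mem n).1.le
      · intro hz
        exact ge_of_tendsto' hu_lim hz
    have hlim : Filter.Tendsto (fun n => μ (Metric.closedBall y (u n))) Filter.atTop
        (nhds (μ (Metric.closedBall y r))) := by
      rw [hInter]
      refine tendsto_measure_iInter_atTop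
        (fun n => Metric.isClosed_closedBall.measurableSet.nullMeasurableSet) ?_ ?_
      · intro m n hmn
        exact Metric.closedBall_subset_closedBall (hu_anti.antitone hmn)
      · exact ⟨0, ((measure_mono (Metric.closedBall_subset_ball (lt_add_one (u 0)))).trans_lt
          (hfin y _)).ne⟩
    have hlim2 := ENNReal.Tendsto.const_mul (a := ENNReal.ofReal C) hlim
      (Or.inr ENNReal.ofReal_ne_top)
    refine ge_of_tendsto' hlim2 fun n => ?_
    have hn := (hu_mem n).1
    calc μ (Metric.closedBall x r) ≤ μ (Metric.ball x (u n)) :=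
          measure_mono (Metric.closedBall_subset_ball hn)
      _ ≤ ENNReal.ofReal C * μ (Metric.ball y (u n)) :=
          h (u n) (hr.trans hn) x y (hxy.trans_lt hn)
      _ ≤ ENNReal.ofReal C * μ (Metric.closedBall y (u n)) := by
          gcongr
          exact Metric.ball_subset_closedBall
  · intro h r hr x y hxy
    obtain ⟨u, hu_mono, hu_mem, hu_lim⟩ := exists_seq_strictMono_tendsto' hxy
    have hUnion : Metric.ball x r = ⋃ n, Metric.closedBall x (u n) := by
      ext z
      simp only [Set.mem_iUnion, Metric.mem_closedBall, Metric.mem_ball]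
      constructor
      · intro hz
        obtain ⟨n, hn⟩ := (hu_lim.eventually (lt_mem_nhds hz)).exists
        exact ⟨n, hn.le⟩
      · rintro ⟨n, hn⟩
        exact hn.trans_lt (hu_mem n).2
    have hmono : Monotone fun n => Metric.closedBall x (u n) := fun m n hmn =>
      Metric.closedBall_subset_closedBall (hu_mono.monotone hmn)
    rw [hUnion, hmono.measure_iUnion]
    refine iSup_le fun n => ?_
    refine (h (u n) (dist_nonneg.trans_lt (hu_mem n).1) x y (hu_mem n).1.le).trans ?_
    gcongr
    exact Metric.closedBall_subset_ball (hu_mem n).2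
end

section
/- Let P be the standard exponential distribution on X = (0,∞). For every r > 0, every ball B(x,r) has P(B(x,r)) > 0, and for every nonnegative f ∈ L¹(P), ∫_{(0,∞)} A_r f dP ≤ 2·∫_{(0,∞)} f dP, where A_r f(x) := (1/P(B(x,r))) ∫_{B(x,r)} f dP. Hence sup_{r>0} ‖A_r‖_{L¹(P)→L¹(P)} ≤ 2. -/
open MeasureTheory Metric ENNReal

/-- The standard exponential distribution on `(0,∞)`, viewed as the measure on `ℝ`
with density `e^{-t}` on `(0,∞)` (and `0` elsewhere). -/
noncomputable def expDist : Measure ℝ :=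
  volume.withDensity ((Set.Ioi (0:ℝ)).indicator fun t => ENNReal.ofReal (Real.exp (-t)))

theorem aux_lint (a b : ℝ) (hab : a ≤ b) (F g : ℝ → ℝ)
    (hF : ∀ x ∈ Set.Icc a b, HasDerivAt F (g x) x) (hg : ContinuousOn g (Set.Icc a b))
    (h0 : ∀ x ∈ Set.Icc a b, 0 ≤ g x) :
    ∫⁻ x in Set.Ioo a b, ENNReal.ofReal (g x) = ENNReal.ofReal (F b - F a) := by
  have hi : IntervalIntegrable g volume a b :=
    ContinuousOn.intervalIntegrable (by rwa [Set.uIcc_of_le hab])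
  have h1 := intervalIntegral.integral_eq_sub_of_hasDerivAt
    (fun x hx => hF x (by rwa [Set.uIcc_of_le hab] at hx)) hi
  rw [← h1, intervalIntegral.integral_of_le hab, integral_Ioc_eq_integral_Ioo]
  rw [ofReal_integral_eq_lintegral_ofReal]
  · exact ((intervalIntegrable_iff_integrableOn_Ioo_of_le hab).1 hi)
  · filter_upwards [ae_restrict_mem measurableSet_Ioo] with x hx
    exact h0 x ⟨hx.1.le, hx.2.le⟩

theorem aux_meas : Measurable ((Set.Ioi (0:ℝ)).indicator fun t => ENNReal.ofReal (Real.exp (-t))) :=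
  Measurable.indicator (by fun_prop) measurableSet_Ioi

theorem aux_P (r x : ℝ) (hr : 0 < r) (hx : 0 < x) :
    expDist (Set.Ioo (x - r) (x + r))
      = ENNReal.ofReal (Real.exp (-(max 0 (x - r))) - Real.exp (-(x + r))) := by
  rw [expDist, withDensity_apply _ measurableSet_Ioo, setLIntegral_indicator measurableSet_Ioi]
  rw [Set.Ioi_inter_Ioo]
  have := aux_lint (max 0 (x - r)) (x + r) (by apply max_le <;> linarith)
    (fun y => - Real.exp (-y)) (fun y => Real.exp (-y))
    (fun y _ => ((hasDerivAt_neg y).exp).neg.congr_deriv (by simp))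
    (by fun_prop) (fun y _ => (Real.exp_pos _).le)
  rw [show (0 ⊔ (x - r)) = max 0 (x-r) from rfl, this]
  congr 1; ring

theorem aux_pos (r x : ℝ) (hr : 0 < r) (hx : 0 < x) :
    0 < Real.exp (-(max 0 (x - r))) - Real.exp (-(x + r)) := by
  have : max 0 (x - r) < x + r := by apply max_lt <;> linarith
  have := Real.exp_lt_exp.2 (neg_lt_neg this)
  linarith

theorem aux_first (r : ℝ) (hr : 0 < r) :
    ∫⁻ x in Set.Ioo 0 r, ENNReal.ofReal (Real.exp (-x) / (1 - Real.exp (-(x + r)))) ≤ 1 := by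
  have hp : ∀ x ∈ Set.Icc 0 r, 0 < 1 - Real.exp (-(x + r)) := by
    intro x hx
    have : Real.exp (-(x + r)) < 1 := Real.exp_lt_one_iff.2 (by linarith [hx.1])
    linarith
  rw [aux_lint 0 r hr.le (fun x => Real.exp r * Real.log (1 - Real.exp (-(x + r))))]
  · rw [ENNReal.ofReal_le_one]
    have e1 : Real.exp (-(r + r)) = Real.exp (-r) ^ 2 := by
      rw [← Real.exp_nat_mul]; congr 1; push_cast; ring
    have h0 := hp 0 ⟨le_rfl, hr.le⟩
    have h1 := Real.exp_pos (-r)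
    simp only [zero_add] at h0 ⊢
    rw [e1, show 1 - Real.exp (-r) ^ 2 = (1 - Real.exp (-r)) * (1 + Real.exp (-r)) by ring,
      Real.log_mul h0.ne' (by positivity)]
    have h2 := Real.log_le_sub_one_of_pos (show 0 < 1 + Real.exp (-r) by positivity)
    have h3 : Real.exp r * Real.exp (-r) = 1 := by rw [← Real.exp_add]; simp
    nlinarith [Real.exp_pos r]
  · intro x hx
    have h := (((((hasDerivAt_id x).add_const r).neg.exp).const_sub 1).log (hp x hx).ne').const_mul
      (Real.exp r)
    refine h.congr_deriv ?_
    have : Real.exp (-x) = Real.exp r * Real.exp (-(x + r)) := by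
      rw [← Real.exp_add]; congr 1; ring
    change Real.exp r * (-(Real.exp (-(x + r)) * -1) / (1 - Real.exp (-(x + r)))) = _
    rw [this]
    ring
  · exact ContinuousOn.div (by fun_prop) (by fun_prop) (fun x hx => (hp x hx).ne')
  · intro x hx
    exact div_nonneg (Real.exp_pos _).le (hp x hx).le

theorem aux_kernel (r t : ℝ) (hr : 0 < r) :
    ∫⁻ x in Set.Ioi (0:ℝ), (Set.Ioo (t - r) (t + r)).indicator (fun x =>
      (ENNReal.ofReal (Real.exp (-(max 0 (x - r))) - Real.exp (-(x + r))))⁻¹) x ∂expDist ≤ 2 := by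
  have hm : Measurable ((Set.Ioo (t - r) (t + r)).indicator (fun x =>
      (ENNReal.ofReal (Real.exp (-(max 0 (x - r))) - Real.exp (-(x + r))))⁻¹)) :=
    Measurable.indicator (by fun_prop) measurableSet_Ioo
  rw [expDist, setLIntegral_withDensity_eq_setLIntegral_mul _ aux_meas hm measurableSet_Ioi]
  have hs : 0 < Real.exp r - Real.exp (-r) := by
    have := Real.exp_lt_exp.2 (show -r < r by linarith)
    linarith
  have hs2 : 2 * r ≤ Real.exp r - Real.exp (-r) := by
    have := Real.self_le_sinh_iff.2 hr.le
    rw [Real.sinh_eq] at this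
    linarith
  calc _ ≤ ∫⁻ x in Set.Ioi (0:ℝ), ((Set.Ioo 0 r).indicator (fun x =>
            ENNReal.ofReal (Real.exp (-x) / (1 - Real.exp (-(x + r))))) x
          + (Set.Ioo (t - r) (t + r)).indicator
            (fun _ => ENNReal.ofReal (1 / (Real.exp r - Real.exp (-r)))) x) := by
        refine setLIntegral_mono' measurableSet_Ioi fun x hx => ?_
        have hx' : 0 < x := hx
        simp only [Pi.mul_apply, Set.indicator_of_mem hx]
        by_cases hxt : x ∈ Set.Ioo (t - r) (t + r)
        · have hpos := aux_pos r x hr hx'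
          rw [Set.indicator_of_mem hxt, Set.indicator_of_mem hxt, ← div_eq_mul_inv,
            ← ENNReal.ofReal_div_of_pos hpos]
          by_cases hxr : x < r
          · rw [Set.indicator_of_mem (show x ∈ Set.Ioo 0 r from ⟨hx', hxr⟩)]
            rw [max_eq_left (by linarith)]
            simp
          · refine le_trans (le_of_eq ?_) le_add_self
            rw [max_eq_right (by linarith)]
            congr 1
            rw [show -(x - r) = -x + r by ring, show -(x + r) = -x + -r by ring, Real.exp_add,
              Real.exp_add, ← mul_sub]
            have := Real.exp_pos (-x)
            field_simp
        · rw [Set.indicator_of_notMem hxt]; simp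
    _ ≤ ∫⁻ x, ((Set.Ioo 0 r).indicator (fun x =>
            ENNReal.ofReal (Real.exp (-x) / (1 - Real.exp (-(x + r))))) x
          + (Set.Ioo (t - r) (t + r)).indicator
            (fun _ => ENNReal.ofReal (1 / (Real.exp r - Real.exp (-r)))) x) :=
        setLIntegral_le_lintegral _ _
    _ ≤ 1 + 1 := by
        rw [lintegral_add_left (Measurable.indicator (by fun_prop) measurableSet_Ioo),
          lintegral_indicator measurableSet_Ioo, lintegral_indicator measurableSet_Ioo]
        refine add_le_add (aux_first r hr) ?_
        rw [setLIntegral_const, Real.volume_Ioo, ← ENNReal.ofReal_mul (by positivity),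
          ENNReal.ofReal_le_one, one_div, inv_mul_le_iff₀ hs]
        linarith
    _ = 2 := by norm_num

/-- For the standard exponential distribution `P` on `(0,∞)`, all balls have positive
measure, and the averaging operators `A_r` are uniformly bounded on `L¹(P)` with
norm at most `2`. Here `B(x,r) = (x - r, x + r) ∩ (0,∞)` and
`A_r f (x) = (1 / P(B(x,r))) ∫_{B(x,r)} f dP`. -/
theorem expDist_averaging_L1_bound (r : ℝ) (hr : 0 < r) :
    (∀ x : ℝ, 0 < x → 0 < expDist (Set.Ioo (x - r) (x + r))) ∧
    ∀ f : ℝ → ℝ≥0∞, Measurable f → (∫⁻ t, f t ∂expDist) < ⊤ →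
      (∫⁻ x in Set.Ioi (0:ℝ),
          (∫⁻ t in Set.Ioo (x - r) (x + r), f t ∂expDist) /
            expDist (Set.Ioo (x - r) (x + r)) ∂expDist) ≤
        2 * ∫⁻ t, f t ∂expDist := by
  refine ⟨fun x hx => ?_, fun f hf _ => ?_⟩
  · rw [aux_P r x hr hx]
    exact ENNReal.ofReal_pos.2 (aux_pos r x hr hx)
  have : SFinite expDist := by unfold expDist; infer_instance
  set D : ℝ → ℝ≥0∞ := fun x =>
    (ENNReal.ofReal (Real.exp (-(max 0 (x - r))) - Real.exp (-(x + r))))⁻¹ with hD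
  have hDm : Measurable D := by rw [hD]; fun_prop
  have hind : ∀ x t, (Set.Ioo (x - r) (x + r)).indicator f t * D x
      = f t * (Set.Ioo (t - r) (t + r)).indicator D x := by
    intro x t
    by_cases h : t ∈ Set.Ioo (x - r) (x + r)
    · rw [Set.indicator_of_mem h, Set.indicator_of_mem]
      exact ⟨by linarith [h.2], by linarith [h.1]⟩
    · rw [Set.indicator_of_notMem h, Set.indicator_of_notMem]
      · simp
      · exact fun h' => h ⟨by linarith [h'.2], by linarith [h'.1]⟩
  have hjm : Measurable (Function.uncurry fun x t : ℝ =>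
      f t * (Set.Ioo (t - r) (t + r)).indicator D x) := by
    have hS : MeasurableSet {p : ℝ × ℝ | p.2 - r < p.1 ∧ p.1 < p.2 + r} :=
      MeasurableSet.inter (s₁ := {p : ℝ × ℝ | p.2 - r < p.1}) (s₂ := {p : ℝ × ℝ | p.1 < p.2 + r})
        (measurableSet_lt (by fun_prop) (by fun_prop))
        (measurableSet_lt (by fun_prop) (by fun_prop))
    exact (hf.comp measurable_snd).mul ((hDm.comp measurable_fst).indicator hS)
  calc _ = ∫⁻ x in Set.Ioi (0:ℝ), ∫⁻ t, f t * (Set.Ioo (t - r) (t + r)).indicator D x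
          ∂expDist ∂expDist := by
        refine setLIntegral_congr_fun measurableSet_Ioi fun x hx => ?_
        rw [aux_P r x hr hx, div_eq_mul_inv, ← lintegral_indicator measurableSet_Ioo,
          ← lintegral_mul_const _ (hf.indicator measurableSet_Ioo)]
        exact lintegral_congr fun t => hind x t
    _ = ∫⁻ t, ∫⁻ x in Set.Ioi (0:ℝ), f t * (Set.Ioo (t - r) (t + r)).indicator D x
          ∂expDist ∂expDist := lintegral_lintegral_swap hjm.aemeasurable
    _ = ∫⁻ t, f t * ∫⁻ x in Set.Ioi (0:ℝ), (Set.Ioo (t - r) (t + r)).indicator D x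
          ∂expDist ∂expDist := lintegral_congr fun t =>
            lintegral_const_mul _ (hDm.indicator measurableSet_Ioo)
    _ ≤ ∫⁻ t, f t * 2 ∂expDist := lintegral_mono fun t => by
        gcongr
        exact aux_kernel r t hr
    _ = 2 * ∫⁻ t, f t ∂expDist := by rw [lintegral_mul_const _ hf, mul_comm]
end

section
/- Let P be the standard exponential distribution on X = (0,∞) and let A_1 be the averaging operator at radius 1, A_1 f(x) := (1/P(B(x,1))) ∫_{B(x,1)} f dP. Then the operator norm of A_1 on L¹(P) exceeds 1.27: there exists a nonnegative f ∈ L¹(P) with ∫ f dP > 0 and ∫ A_1 f dP > 1.27·∫ f dP. -/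
open MeasureTheory Metric ENNReal

lemma expDist_apply_aux (s : Set ℝ) (hs : MeasurableSet s) :
    expDist s = ∫⁻ t in Set.Ioi 0 ∩ s, ENNReal.ofReal (Real.exp (-t)) := by
  rw [expDist, withDensity_apply _ hs, setLIntegral_indicator measurableSet_Ioi]

lemma expDist_Ioo (a b : ℝ) (ha : 0 ≤ a) (hab : a ≤ b) :
    expDist (Set.Ioo a b) = ENNReal.ofReal (Real.exp (-a) - Real.exp (-b)) := by
  rw [expDist_apply_aux _ measurableSet_Ioo]
  have h1 : Set.Ioi (0:ℝ) ∩ Set.Ioo a b = Set.Ioo a b := by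
    apply Set.inter_eq_right.2
    intro x hx
    exact lt_of_le_of_lt ha hx.1
  rw [h1, setLIntegral_congr Ioo_ae_eq_Ioc, ← ofReal_integral_eq_lintegral_ofReal,
    ← intervalIntegral.integral_of_le hab]
  · congr 1
    rw [intervalIntegral.integral_eq_sub_of_hasDerivAt (f := fun x => -Real.exp (-x))]
    · ring
    · intro x _
      have h0 := ((hasDerivAt_id x).neg.exp).neg
      refine HasDerivAt.congr_deriv (f := fun x => -Real.exp (-x)) h0 ?_
      simp
    · apply Continuous.intervalIntegrable
      fun_prop
  · exact (Continuous.integrableOn_Icc (by fun_prop)).mono_set Set.Ioc_subset_Icc_self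
  · exact Filter.Eventually.of_forall fun x => (Real.exp_pos _).le

lemma expDist_Ioo_neg (a b : ℝ) (ha : a ≤ 0) :
    expDist (Set.Ioo a b) = expDist (Set.Ioo 0 b) := by
  rw [expDist_apply_aux _ measurableSet_Ioo, expDist_apply_aux _ measurableSet_Ioo]
  congr 2
  ext x
  simp only [Set.mem_inter_iff, Set.mem_Ioi, Set.mem_Ioo]
  constructor
  · rintro ⟨h, _, h2⟩; exact ⟨h, h, h2⟩
  · rintro ⟨h, _, h2⟩; exact ⟨h, by linarith, h2⟩

lemma lint_expDist (s : Set ℝ) (hs : MeasurableSet s) (hs0 : s ⊆ Set.Ioi 0) (g : ℝ → ℝ≥0∞)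
    (h : ℝ → ℝ) (hm : Measurable h)
    (hg : ∀ x ∈ s, g x = ENNReal.ofReal (h x)) :
    ∫⁻ x in s, g x ∂expDist = ∫⁻ x in s, ENNReal.ofReal (Real.exp (-x) * h x) := by
  rw [setLIntegral_congr_fun hs hg, expDist, restrict_withDensity hs,
    lintegral_withDensity_eq_lintegral_mul _ _ hm.ennreal_ofReal]
  · apply setLIntegral_congr_fun hs
    intro x hx
    simp only [Pi.mul_apply, Set.indicator_of_mem (hs0 hx)]
    rw [ENNReal.ofReal_mul (Real.exp_pos _).le]
  · exact Measurable.indicator (by fun_prop) measurableSet_Ioi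

lemma piece_one : ENNReal.ofReal (Real.exp 1 * Real.log (1 + Real.exp (-1))) ≤
    ∫⁻ x in Set.Ioc (0:ℝ) 1, (expDist (Set.Ioo (x - 1) (x + 1)))⁻¹ ∂expDist := by
  have hpos : ∀ x : ℝ, 0 ≤ x → 0 < 1 - Real.exp (-(x+1)) := by
    intro x hx
    have : Real.exp (-(x+1)) < 1 := by
      have h0 : Real.exp (-(x+1)) < Real.exp 0 := Real.exp_lt_exp.2 (by linarith)
      rwa [Real.exp_zero] at h0
    linarith
  rw [lint_expDist _ measurableSet_Ioc (fun x hx => hx.1) _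
    (fun x => (1 - Real.exp (-(x+1)))⁻¹) (by fun_prop)]
  · have hc : ContinuousOn (fun x : ℝ => Real.exp (-x) * (1 - Real.exp (-(x+1)))⁻¹)
        (Set.Icc 0 1) := by
      apply ContinuousOn.mul (by fun_prop)
      apply ContinuousOn.inv₀ (by fun_prop)
      intro x hx
      exact (hpos x hx.1).ne'
    rw [← ofReal_integral_eq_lintegral_ofReal, ← intervalIntegral.integral_of_le zero_le_one]
    · apply le_of_eq
      congr 1
      rw [intervalIntegral.integral_eq_sub_of_hasDerivAt
        (f := fun x => Real.exp 1 * Real.log (1 - Real.exp (-(x+1))))]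
      · rw [← mul_sub, ← Real.log_div (hpos 1 (by norm_num)).ne' (hpos 0 le_rfl).ne']
        congr 2
        rw [eq_div_iff (hpos 0 le_rfl).ne']
        have : Real.exp (-(1+1)) = Real.exp (-1) * Real.exp (-1) := by
          rw [← Real.exp_add]; norm_num
        rw [this]
        norm_num
        ring
      · intro x hx
        rw [Set.uIcc_of_le zero_le_one] at hx
        have h1 : HasDerivAt (fun x : ℝ => 1 - Real.exp (-(x+1))) (Real.exp (-(x+1))) x := by
          have := ((((hasDerivAt_id x).add_const 1).neg.exp).const_sub 1)
          simpa using this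
        have h2 := (h1.log (hpos x hx.1).ne').const_mul (Real.exp 1)
        refine h2.congr_deriv ?_
        symm
        rw [div_eq_mul_inv, ← mul_assoc, ← Real.exp_add]
        congr 2
        ring
      · apply ContinuousOn.intervalIntegrable
        rwa [Set.uIcc_of_le zero_le_one]
    · exact hc.integrableOn_Icc.mono_set Set.Ioc_subset_Icc_self
    · refine (ae_restrict_iff' measurableSet_Ioc).2 (Filter.Eventually.of_forall fun x hx => ?_)
      have := hpos x hx.1.le
      simp only [Pi.zero_apply]
      positivity
  · intro x hx
    rw [expDist_Ioo_neg _ _ (by linarith [hx.2]), expDist_Ioo _ _ le_rfl (by linarith [hx.1])]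
    rw [ENNReal.ofReal_inv_of_pos (hpos x hx.1.le)]
    simp

lemma piece_two : ENNReal.ofReal (0.99 * (Real.exp 1 - Real.exp (-1))⁻¹) ≤
    ∫⁻ x in Set.Ioo (1:ℝ) 1.99, (expDist (Set.Ioo (x - 1) (x + 1)))⁻¹ ∂expDist := by
  have hp : 0 < Real.exp 1 - Real.exp (-1) := by
    have : Real.exp (-1) < Real.exp 1 := Real.exp_lt_exp.2 (by norm_num)
    linarith
  rw [lint_expDist _ measurableSet_Ioo (fun x hx => lt_trans zero_lt_one hx.1) _
    (fun x => (Real.exp (-x) * (Real.exp 1 - Real.exp (-1)))⁻¹) (by fun_prop)]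
  · have : ∀ x : ℝ, Real.exp (-x) * (Real.exp (-x) * (Real.exp 1 - Real.exp (-1)))⁻¹
        = (Real.exp 1 - Real.exp (-1))⁻¹ := by
      intro x
      have := Real.exp_pos (-x)
      field_simp
    simp only [this]
    rw [setLIntegral_const, Real.volume_Ioo, ← ENNReal.ofReal_mul (by positivity)]
    apply le_of_eq
    congr 1
    ring
  · intro x hx
    have h1 : Real.exp (-(x-1)) = Real.exp (-x) * Real.exp 1 := by
      rw [← Real.exp_add]; congr 1; ring
    have h2 : Real.exp (-(x+1)) = Real.exp (-x) * Real.exp (-1) := by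
      rw [← Real.exp_add]; congr 1; ring
    rw [expDist_Ioo _ _ (by linarith [hx.1]) (by linarith [hx.1]), h1, h2, ← mul_sub,
      ENNReal.ofReal_inv_of_pos (by positivity)]

lemma numeric : (1.27:ℝ) < Real.exp 1 * Real.log (1 + Real.exp (-1)) +
    0.99 * (Real.exp 1 - Real.exp (-1))⁻¹ := by
  have e1 := Real.exp_one_gt_d9
  have e2 := Real.exp_one_lt_d9
  have e3 : (0.36787:ℝ) < Real.exp (-1) := by
    rw [Real.exp_neg, lt_inv_comm₀ (by norm_num) (by positivity)]
    exact lt_trans e2 (by norm_num)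
  have l : (0.313:ℝ) ≤ Real.log (1 + Real.exp (-1)) := by
    rw [Real.le_log_iff_exp_le (by positivity)]
    have := Real.exp_bound' (x := 0.313) (by norm_num) (by norm_num) (n := 5) (by norm_num)
    refine this.trans (le_trans ?_ (show (1.36787:ℝ) ≤ _ by linarith))
    norm_num [Finset.sum_range_succ, Nat.factorial]
  have c : (0.4254:ℝ) ≤ (Real.exp 1 - Real.exp (-1))⁻¹ := by
    rw [le_inv_comm₀ (by norm_num) (by
      have : Real.exp (-1) < Real.exp 1 := Real.exp_lt_exp.2 (by norm_num)
      linarith)]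
    refine le_trans (show _ ≤ (2.35042:ℝ) by linarith) (by norm_num)
  nlinarith

/-- For the standard exponential distribution `P` on `(0,∞)`, the operator norm on
`L¹(P)` of the averaging operator `A_1` at radius `1` exceeds `1.27`: there is a
nonnegative `f ∈ L¹(P)` with `∫ f dP > 0` and `∫ A_1 f dP > 1.27 ∫ f dP`.
Here `B(x,1) = (x - 1, x + 1) ∩ (0,∞)` and
`A_1 f (x) = (1 / P(B(x,1))) ∫_{B(x,1)} f dP`. -/
theorem expDist_A1_L1_norm_gt :
    ∃ f : ℝ → ℝ≥0∞, Measurable f ∧ 0 < (∫⁻ t, f t ∂expDist) ∧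
      (∫⁻ t, f t ∂expDist) < ⊤ ∧
      ENNReal.ofReal 1.27 * (∫⁻ t, f t ∂expDist) <
        ∫⁻ x in Set.Ioi (0:ℝ),
          (∫⁻ t in Set.Ioo (x - 1) (x + 1), f t ∂expDist) /
            expDist (Set.Ioo (x - 1) (x + 1)) ∂expDist := by
  have hS : expDist (Set.Ioo 0.99 1) = ENNReal.ofReal (Real.exp (-0.99) - Real.exp (-1)) :=
    expDist_Ioo _ _ (by norm_num) (by norm_num)
  have hpos : 0 < expDist (Set.Ioo 0.99 1) := by
    rw [hS, ENNReal.ofReal_pos, sub_pos]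
    exact Real.exp_lt_exp.2 (by norm_num)
  have hfin : expDist (Set.Ioo 0.99 1) < ⊤ := by
    rw [hS]; exact ENNReal.ofReal_lt_top
  have hi : ∫⁻ t, (Set.Ioo (0.99:ℝ) 1).indicator (fun _ => (1:ℝ≥0∞)) t ∂expDist
      = expDist (Set.Ioo 0.99 1) := by
    rw [lintegral_indicator measurableSet_Ioo]; simp
  refine ⟨(Set.Ioo (0.99:ℝ) 1).indicator fun _ => 1,
    measurable_const.indicator measurableSet_Ioo, ?_, ?_, ?_⟩
  · rw [hi]; exact hpos
  · rw [hi]; exact hfin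
  rw [hi]
  have hp2 : (0:ℝ) ≤ 0.99 * (Real.exp 1 - Real.exp (-1))⁻¹ := by
    have : Real.exp (-1) < Real.exp 1 := Real.exp_lt_exp.2 (by norm_num)
    have : 0 < Real.exp 1 - Real.exp (-1) := by linarith
    positivity
  have hp1 : (0:ℝ) ≤ Real.exp 1 * Real.log (1 + Real.exp (-1)) := by
    have : 0 ≤ Real.log (1 + Real.exp (-1)) := Real.log_nonneg (by linarith [Real.exp_pos (-1)])
    positivity
  have key : ENNReal.ofReal 1.27 < ∫⁻ x in Set.Ioo (0:ℝ) 1.99,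
      (expDist (Set.Ioo (x - 1) (x + 1)))⁻¹ ∂expDist := by
    have hu : Set.Ioo (0:ℝ) 1.99 = Set.Ioc 0 1 ∪ Set.Ioo 1 1.99 :=
      (Set.Ioc_union_Ioo_eq_Ioo (by norm_num) (by norm_num)).symm
    rw [hu, lintegral_union measurableSet_Ioo]
    · refine lt_of_lt_of_le ?_ (add_le_add piece_one piece_two)
      rw [← ENNReal.ofReal_add hp1 hp2]
      exact (ENNReal.ofReal_lt_ofReal_iff (by linarith [numeric])).2 numeric
    · rw [Set.disjoint_left]
      intro x hx hy
      exact absurd hx.2 (not_le.2 hy.1)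
  calc _ < (∫⁻ x in Set.Ioo (0:ℝ) 1.99,
      (expDist (Set.Ioo (x - 1) (x + 1)))⁻¹ ∂expDist) * expDist (Set.Ioo 0.99 1) :=
        ENNReal.mul_lt_mul_left hpos.ne' hfin.ne key
    _ = ∫⁻ x in Set.Ioo (0:ℝ) 1.99,
      (expDist (Set.Ioo (x - 1) (x + 1)))⁻¹ * expDist (Set.Ioo 0.99 1) ∂expDist := by
        rw [lintegral_mul_const' _ _ hfin.ne]
    _ = ∫⁻ x in Set.Ioo (0:ℝ) 1.99,
          (∫⁻ t in Set.Ioo (x - 1) (x + 1),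
            (Set.Ioo (0.99:ℝ) 1).indicator (fun _ => (1:ℝ≥0∞)) t ∂expDist) /
            expDist (Set.Ioo (x - 1) (x + 1)) ∂expDist := by
        apply setLIntegral_congr_fun measurableSet_Ioo
        intro x hx
        have hx1 := hx.1
        have hx2 := hx.2
        have hsub : Set.Ioo (0.99:ℝ) 1 ∩ Set.Ioo (x-1) (x+1) = Set.Ioo 0.99 1 := by
          apply Set.inter_eq_left.2
          apply Set.Ioo_subset_Ioo <;> linarith
        simp only []
        rw [setLIntegral_indicator measurableSet_Ioo, hsub, setLIntegral_one, mul_comm,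
          div_eq_mul_inv]
    _ ≤ _ := lintegral_mono_set fun x hx => hx.1
end

section
/- Let γ^d be the standard Gaussian measure on ℝ^d and for r > 0 let A_r be the averaging operator A_r f(x) := (1/γ^d(B(x,r))) ∫_{B(x,r)} f dγ^d. For every p ∈ [1,∞) there exists D such that for all d ≥ D the weak type (p,p) constant of A_{√(3d−3)/2} exceeds 1.019^{d/p}: there exist a nonzero nonnegative f ∈ L^p(γ^d) and α > 0 with α^p·γ^d({x : A_{√(3d−3)/2} f(x) ≥ α}) > 1.019^d·‖f‖_{L^p(γ^d)}^p. -/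
open MeasureTheory Metric ENNReal

/-- The standard Gaussian measure on `ℝ^d`, with density
`(2π)^{-d/2} e^{-‖x‖²/2}` with respect to Lebesgue measure. -/
noncomputable def stdGaussian (d : ℕ) : Measure (EuclideanSpace ℝ (Fin d)) :=
  volume.withDensity fun x =>
    ENNReal.ofReal ((2 * Real.pi) ^ (-(d : ℝ) / 2) * Real.exp (-‖x‖ ^ 2 / 2))

/-- The averaging operator `A_r` (for nonnegative functions) associated to the standard
Gaussian measure: `A_r f (x) = (1 / γ^d(B(x,r))) ∫_{B(x,r)} f dγ^d`. -/
noncomputable def gaussAvg (d : ℕ) (r : ℝ) (f : EuclideanSpace ℝ (Fin d) → ℝ≥0∞)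
    (x : EuclideanSpace ℝ (Fin d)) : ℝ≥0∞ :=
  (∫⁻ y in Metric.ball x r, f y ∂stdGaussian d) / stdGaussian d (Metric.ball x r)


namespace GW

variable {d : ℕ}

lemma gauss_lint (b : ℝ) (hb : 0 < b) (w : EuclideanSpace ℝ (Fin d)) :
    ∫⁻ y, ENNReal.ofReal (Real.exp (-b * ‖y‖ ^ 2 + inner ℝ w y)) =
      ENNReal.ofReal ((Real.pi / b) ^ ((d : ℝ) / 2) * Real.exp (‖w‖ ^ 2 / (4 * b))) := by
  have h0 : ∫⁻ y : EuclideanSpace ℝ (Fin d), ENNReal.ofReal (Real.exp (-b * ‖y‖ ^ 2)) =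
      ENNReal.ofReal ((Real.pi / b) ^ ((d : ℝ) / 2)) := by
    have := GaussianFourier.integral_rexp_neg_mul_sq_norm (V := EuclideanSpace ℝ (Fin d)) hb
    rw [finrank_euclideanSpace_fin] at this
    rw [← this, ofReal_integral_eq_lintegral_ofReal]
    · by_contra hn
      rw [integral_undef hn] at this
      have : 0 < (Real.pi / b) ^ ((d : ℝ) / 2) := by positivity
      linarith
    · exact Filter.Eventually.of_forall fun y => (Real.exp_pos _).le
  have h1 : ∀ y : EuclideanSpace ℝ (Fin d),
      ENNReal.ofReal (Real.exp (-b * ‖y‖ ^ 2 + inner ℝ w y)) =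
      ENNReal.ofReal (Real.exp (-b * ‖y - (1 / (2 * b)) • w‖ ^ 2)) *
        ENNReal.ofReal (Real.exp (‖w‖ ^ 2 / (4 * b))) := by
    intro y
    rw [← ENNReal.ofReal_mul (Real.exp_pos _).le, ← Real.exp_add]
    congr 2
    rw [norm_sub_sq_real, inner_smul_right, norm_smul, Real.norm_of_nonneg (by positivity),
      real_inner_comm]
    field_simp
    ring
  simp_rw [h1]
  rw [lintegral_mul_const _ (by fun_prop),
    lintegral_sub_right_eq_self (fun y => ENNReal.ofReal (Real.exp (-b * ‖y‖ ^ 2))), h0,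
    ENNReal.ofReal_mul (by positivity)]

/-- unnormalized Gaussian mass of a set -/
noncomputable def J (b : ℝ) (w : EuclideanSpace ℝ (Fin d)) (S : Set (EuclideanSpace ℝ (Fin d))) :
    ℝ≥0∞ :=
  ∫⁻ y in S, ENNReal.ofReal (Real.exp (-b * ‖y‖ ^ 2 + inner ℝ w y))

lemma J_mono (b : ℝ) (w : EuclideanSpace ℝ (Fin d)) {S T : Set (EuclideanSpace ℝ (Fin d))}
    (h : S ⊆ T) : J b w S ≤ J b w T := lintegral_mono_set h

lemma J_union (b : ℝ) (w : EuclideanSpace ℝ (Fin d)) (S T : Set (EuclideanSpace ℝ (Fin d))) :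
    J b w (S ∪ T) ≤ J b w S + J b w T := lintegral_union_le _ _ _

lemma chernoff (b c T : ℝ) (hb : 0 < b - c) (w : EuclideanSpace ℝ (Fin d)) :
    J b w {y | c * T ≤ c * ‖y‖ ^ 2} ≤
      ENNReal.ofReal (Real.exp (-c * T) * ((Real.pi / (b - c)) ^ ((d : ℝ) / 2) *
        Real.exp (‖w‖ ^ 2 / (4 * (b - c))))) := by
  rw [ENNReal.ofReal_mul (Real.exp_pos _).le, ← gauss_lint (b - c) hb w,
    ← lintegral_const_mul _ (by fun_prop)]
  unfold J
  refine le_trans (setLIntegral_mono (g := fun y => ENNReal.ofReal (Real.exp (-c * T)) *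
    ENNReal.ofReal (Real.exp (-(b - c) * ‖y‖ ^ 2 + inner ℝ w y))) (by fun_prop) ?_)
    (setLIntegral_le_lintegral _ _)
  intro y hy
  simp only [Set.mem_ofPred_eq] at hy
  rw [← ENNReal.ofReal_mul (Real.exp_pos _).le, ← Real.exp_add]
  apply ENNReal.ofReal_le_ofReal
  apply Real.exp_le_exp.mpr
  nlinarith

lemma neg_log_le {c : ℝ} (h1 : -(1/4) ≤ c) (h2 : c ≤ 1 / 4) : -Real.log (1 - c) ≤ c + c ^ 2 := by
  have h := Real.abs_log_sub_add_sum_range_le (x := c) (by rw [abs_lt]; constructor <;> linarith) 2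
  simp [Finset.sum_range_succ] at h
  have h3 := (abs_le.mp h).1
  have hc : |c| ≤ 1/4 := abs_le.mpr ⟨h1, h2⟩
  have h4 : |c| ^ 3 / (1 - |c|) ≤ c ^ 2 / 2 := by
    rw [div_le_iff₀ (by linarith), ← sq_abs c]
    nlinarith [sq_nonneg (|c|)]
  norm_num at h3
  linarith

/-- tails of the tilted Gaussian -/
lemma tail1 (q t : ℝ) (hq : 0 ≤ q) (hq1 : q ≤ 1) (x : EuclideanSpace ℝ (Fin d))
    (hx : ‖x‖ ^ 2 = q * d) (h1 : |t - (1 / 2 + q / 4)| ≤ 1 / 2) :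
    J 1 x {y | (t - (1 / 2 + q / 4)) * (t * d) ≤ (t - (1 / 2 + q / 4)) * ‖y‖ ^ 2} ≤
      ENNReal.ofReal (Real.exp (-(d * (t - (1 / 2 + q / 4)) ^ 2 / 4))) * J 1 x Set.univ := by
  set c := (t - (1 / 2 + q / 4)) / 2 with hc
  have hc' : t - (1 / 2 + q / 4) = 2 * c := by rw [hc]; ring
  rw [hc'] at h1 ⊢
  have hc1 : -(1/4) ≤ c := by linarith [(abs_le.mp h1).1]
  have hc2 : c ≤ 1/4 := by linarith [(abs_le.mp h1).2]
  have ht : t = 2 * c + 1 / 2 + q / 4 := by linarith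
  have e : {y : EuclideanSpace ℝ (Fin d) | 2 * c * (t * d) ≤ 2 * c * ‖y‖ ^ 2} =
      {y | c * (t * d) ≤ c * ‖y‖ ^ 2} := by
    ext y; simp only [Set.mem_ofPred_eq]; constructor <;> intro h <;> linarith
  rw [e]
  refine (chernoff 1 c (t * d) (by linarith) x).trans ?_
  rw [J, setLIntegral_univ, gauss_lint 1 one_pos, ← ENNReal.ofReal_mul (Real.exp_pos _).le]
  apply ENNReal.ofReal_le_ofReal
  have hpos : 0 < 1 - c := by linarith
  rw [Real.div_rpow Real.pi_pos.le hpos.le, div_one]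
  have hP : 0 < Real.pi ^ ((d : ℝ) / 2) := by positivity
  have hl : ((1 - c) ^ ((d : ℝ) / 2))⁻¹ = Real.exp (-Real.log (1 - c) * (d / 2)) := by
    rw [Real.rpow_def_of_pos hpos, ← Real.exp_neg]; congr 1; ring
  rw [div_eq_mul_inv, hl, hx]
  have key : Real.exp (-c * (t * d)) * (Real.exp (-Real.log (1 - c) * (d / 2)) *
      Real.exp (q * d / (4 * (1 - c)))) ≤ Real.exp (-(d * (2 * c) ^ 2 / 4)) *
      Real.exp (q * d / (4 * 1)) := by
    simp only [← Real.exp_add]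
    apply Real.exp_le_exp.mpr
    have hlog := neg_log_le hc1 hc2
    have h3 : 1 / (1 - c) ≤ 1 + c + 2 * c ^ 2 := by
      rw [div_le_iff₀ hpos]
      nlinarith [mul_nonneg (sq_nonneg c) (by linarith : 0 ≤ 1 - 2 * c)]
    have hd : (0 : ℝ) ≤ d := Nat.cast_nonneg d
    have h4 : q * d / (4 * (1 - c)) = q * d / 4 * (1 / (1 - c)) := by field_simp
    rw [h4, ht]
    have h5 := mul_le_mul_of_nonneg_left h3 (by positivity : 0 ≤ q * d / 4)
    have h6 := mul_le_mul_of_nonneg_right hlog (by positivity : (0 : ℝ) ≤ d / 2)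
    have h7 : 0 ≤ d * c ^ 2 * (1 - q) := mul_nonneg (by positivity) (by linarith)
    nlinarith
  calc _ = Real.pi ^ ((d : ℝ) / 2) * (Real.exp (-c * (t * d)) * (Real.exp (-Real.log (1 - c) * (d / 2)) *
      Real.exp (q * d / (4 * (1 - c))))) := by ring
    _ ≤ Real.pi ^ ((d : ℝ) / 2) * (Real.exp (-(d * (2 * c) ^ 2 / 4)) *
      Real.exp (q * d / (4 * 1))) := mul_le_mul_of_nonneg_left key hP.le
    _ = _ := by ring

/-- tails of the centered Gaussian -/
lemma tail2 (q t : ℝ) (hq : 0 < q) (hq1 : q ≤ 1) (h1 : |t - q| ≤ 1 / 2) :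
    J (1 / (2 * q)) (0 : EuclideanSpace ℝ (Fin d)) {y | (t - q) * (t * d) ≤ (t - q) * ‖y‖ ^ 2} ≤
      ENNReal.ofReal (Real.exp (-(d * (t - q) ^ 2 / 8))) *
        J (1 / (2 * q)) (0 : EuclideanSpace ℝ (Fin d)) Set.univ := by
  set c := (t - q) / 4 with hc
  have hc' : t - q = 4 * c := by rw [hc]; ring
  rw [hc'] at h1 ⊢
  have hc1 : -(1/8) ≤ c := by linarith [(abs_le.mp h1).1]
  have hc2 : c ≤ 1/8 := by linarith [(abs_le.mp h1).2]
  have ht : t = 4 * c + q := by linarith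
  have e : {y : EuclideanSpace ℝ (Fin d) | 4 * c * (t * d) ≤ 4 * c * ‖y‖ ^ 2} =
      {y | c * (t * d) ≤ c * ‖y‖ ^ 2} := by
    ext y; simp only [Set.mem_ofPred_eq]; constructor <;> intro h <;> linarith
  rw [e]
  have hz1 : -(1/4) ≤ 2 * q * c := by nlinarith
  have hz2 : 2 * q * c ≤ 1/4 := by nlinarith
  have hb : 1 / (2 * q) - c = (1 - 2 * q * c) / (2 * q) := by field_simp
  have hpos : 0 < 1 - 2 * q * c := by linarith
  refine (chernoff (1 / (2 * q)) c (t * d) (by rw [hb]; positivity) 0).trans ?_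
  rw [J, setLIntegral_univ, gauss_lint _ (by positivity), ← ENNReal.ofReal_mul (Real.exp_pos _).le]
  apply ENNReal.ofReal_le_ofReal
  have e1 : Real.pi / (1 / (2 * q) - c) = (2 * Real.pi * q) / (1 - 2 * q * c) := by
    rw [hb]; field_simp
  have e2 : Real.pi / (1 / (2 * q)) = 2 * Real.pi * q := by field_simp
  rw [e1, e2, Real.div_rpow (by positivity) hpos.le]
  have hP : 0 < (2 * Real.pi * q) ^ ((d : ℝ) / 2) := by positivity
  have hl : ((1 - 2 * q * c) ^ ((d : ℝ) / 2))⁻¹ = Real.exp (-Real.log (1 - 2 * q * c) * (d / 2)) := by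
    rw [Real.rpow_def_of_pos hpos, ← Real.exp_neg]; congr 1; ring
  rw [div_eq_mul_inv, hl]
  simp only [norm_zero, ne_eq, OfNat.ofNat_ne_zero, not_false_eq_true, zero_pow, zero_div,
    Real.exp_zero, mul_one]
  have key : Real.exp (-c * (t * d)) * Real.exp (-Real.log (1 - 2 * q * c) * (d / 2)) ≤
      Real.exp (-(d * (4 * c) ^ 2 / 8)) := by
    simp only [← Real.exp_add]
    apply Real.exp_le_exp.mpr
    have hlog := neg_log_le hz1 hz2
    have hd : (0 : ℝ) ≤ d := Nat.cast_nonneg d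
    have h6 := mul_le_mul_of_nonneg_right hlog (by positivity : (0 : ℝ) ≤ d / 2)
    have h7 : 0 ≤ d * c ^ 2 * (1 - q ^ 2) := mul_nonneg (by positivity) (by nlinarith)
    rw [ht]
    nlinarith
  calc _ = (2 * Real.pi * q) ^ ((d : ℝ) / 2) * (Real.exp (-c * (t * d)) *
        Real.exp (-Real.log (1 - 2 * q * c) * (d / 2))) := by ring
    _ ≤ (2 * Real.pi * q) ^ ((d : ℝ) / 2) * Real.exp (-(d * (4 * c) ^ 2 / 8)) :=
      mul_le_mul_of_nonneg_left key hP.le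
    _ = _ := by ring

/-- reflection invariance of the tilted Gaussian -/
lemma J_reflect (x : EuclideanSpace ℝ (Fin d)) (P : ℝ → Prop)
    (hP : MeasurableSet {y : EuclideanSpace ℝ (Fin d) | P (‖y‖ ^ 2)})
    (hP' : MeasurableSet {y : EuclideanSpace ℝ (Fin d) | P (‖y - x‖ ^ 2)}) :
    J 1 x {y | P (‖y - x‖ ^ 2)} = J 1 x {y | P (‖y‖ ^ 2)} := by
  unfold J
  rw [← lintegral_indicator hP, ← lintegral_indicator hP']
  rw [← lintegral_sub_left_eq_self ({y | P (‖y - x‖ ^ 2)}.indicator _) x]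
  refine lintegral_congr fun y => ?_
  have h1 : x - y ∈ {y : EuclideanSpace ℝ (Fin d) | P (‖y - x‖ ^ 2)} ↔
      y ∈ {y : EuclideanSpace ℝ (Fin d) | P (‖y‖ ^ 2)} := by
    simp only [Set.mem_ofPred_eq, sub_sub_cancel_left, norm_neg]
  by_cases h : y ∈ {y : EuclideanSpace ℝ (Fin d) | P (‖y‖ ^ 2)}
  · rw [Set.indicator_of_mem h, Set.indicator_of_mem (h1.mpr h)]
    congr 2
    rw [norm_sub_sq_real, inner_sub_right, real_inner_self_eq_norm_sq]
    ring
  · rw [Set.indicator_of_notMem h, Set.indicator_of_notMem (fun h' => h (h1.mp h'))]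

lemma gam (S : Set (EuclideanSpace ℝ (Fin d))) (hS : MeasurableSet S) :
    stdGaussian d S = ENNReal.ofReal ((2 * Real.pi) ^ (-(d : ℝ) / 2)) * J (1 / 2) 0 S := by
  rw [stdGaussian, withDensity_apply _ hS, J, ← lintegral_const_mul _ (by fun_prop)]
  refine lintegral_congr fun y => ?_
  rw [← ENNReal.ofReal_mul (by positivity), inner_zero_left]
  congr 3
  ring

lemma gam_pos (S : Set (EuclideanSpace ℝ (Fin d))) (hopen : IsOpen S) (hne : S.Nonempty) :
    0 < stdGaussian d S := by
  rw [gam S hopen.measurableSet]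
  apply ENNReal.mul_pos
  · rw [ne_eq, ENNReal.ofReal_eq_zero, not_le]; positivity
  · have hv := hopen.measure_pos volume hne
    unfold J
    rw [← pos_iff_ne_zero, setLIntegral_pos_iff (by fun_prop)]
    convert hv using 2
    apply Set.inter_eq_right.mpr
    intro y _
    rw [Function.mem_support, ne_eq, ENNReal.ofReal_eq_zero, not_le]
    positivity

lemma cmp_exp (x y : EuclideanSpace ℝ (Fin d)) : -(1 / 2) * ‖y‖ ^ 2 + inner ℝ 0 y =
    (‖y - x‖ ^ 2 - ‖x‖ ^ 2) / 2 + (-1 * ‖y‖ ^ 2 + inner ℝ x y) := by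
  rw [norm_sub_sq_real, inner_zero_left, real_inner_comm]; ring

lemma cmp1 (x : EuclideanSpace ℝ (Fin d)) (T : ℝ) (S : Set (EuclideanSpace ℝ (Fin d)))
    (hS : MeasurableSet S) (h : ∀ y ∈ S, ‖y - x‖ ^ 2 ≤ T) :
    J (1 / 2) 0 S ≤ ENNReal.ofReal (Real.exp ((T - ‖x‖ ^ 2) / 2)) * J 1 x S := by
  rw [J, J, ← lintegral_const_mul _ (by fun_prop)]
  refine setLIntegral_mono' hS fun y hy => ?_
  rw [← ENNReal.ofReal_mul (Real.exp_pos _).le, ← Real.exp_add, cmp_exp x y]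
  apply ENNReal.ofReal_le_ofReal
  apply Real.exp_le_exp.mpr
  linarith [h y hy]

lemma cmp2 (x : EuclideanSpace ℝ (Fin d)) (T : ℝ) (S : Set (EuclideanSpace ℝ (Fin d)))
    (hS : MeasurableSet S) (h : ∀ y ∈ S, T ≤ ‖y - x‖ ^ 2) :
    ENNReal.ofReal (Real.exp ((T - ‖x‖ ^ 2) / 2)) * J 1 x S ≤ J (1 / 2) 0 S := by
  rw [J, J, ← lintegral_const_mul _ (by fun_prop)]
  refine setLIntegral_mono' hS fun y hy => ?_
  rw [← ENNReal.ofReal_mul (Real.exp_pos _).le, ← Real.exp_add, cmp_exp x y]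
  apply ENNReal.ofReal_le_ofReal
  apply Real.exp_le_exp.mpr
  linarith [h y hy]

lemma J_univ_lt_top (b : ℝ) (hb : 0 < b) (w : EuclideanSpace ℝ (Fin d)) :
    J b w Set.univ < ⊤ := by
  rw [J, setLIntegral_univ, gauss_lint b hb]
  exact ENNReal.ofReal_lt_top

/-- the set where the test function lives -/
def B0 (d : ℕ) : Set (EuclideanSpace ℝ (Fin d)) := {y | ‖y‖ ^ 2 < 0.75004 * d}

lemma meas_B0 : MeasurableSet (B0 d) := measurableSet_lt (by fun_prop) (by fun_prop)

lemma half_le {I a b : ℝ≥0∞} (hI : I < ⊤) (h : I ≤ a + b) (hb : b ≤ ENNReal.ofReal (1 / 2) * I) :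
    ENNReal.ofReal (1 / 2) * I ≤ a := by
  lift I to NNReal using hI.ne
  have hb' : b < ⊤ := lt_of_le_of_lt hb (by finiteness)
  lift b to NNReal using hb'.ne
  by_cases ha : a = ⊤
  · simp [ha]
  lift a to NNReal using ha
  have e : ENNReal.ofReal (1 / 2) = ((1 / 2 : NNReal) : ℝ≥0∞) := by
    rw [← ENNReal.ofReal_coe_nnreal]; simp
  rw [e] at hb ⊢
  norm_cast at hb h ⊢
  have hb2 : (b : ℝ) ≤ (1 / 2 : NNReal) * I := by exact_mod_cast hb
  push_cast at hb2
  have h2 : (I : ℝ) ≤ a + b := by exact_mod_cast h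
  have : (1 / 2 : ℝ) * I ≤ a := by linarith
  exact_mod_cast this

lemma main_ball (κ : ℝ) (hκ : κ = 1 / 2500000000) (x : EuclideanSpace ℝ (Fin d)) (q R : ℝ)
    (hR0 : 0 ≤ R)
    (hx : ‖x‖ ^ 2 = q * d) (hq1 : 1 - 3 * κ ≤ q) (hq2 : q ≤ 1 - κ)
    (hR1 : (3 / 4 - κ / 8) * d ≤ R ^ 2) (hR2 : R ^ 2 ≤ 3 / 4 * d)
    (hd1 : Real.exp (-(d * (κ / 8) ^ 2 / 4)) ≤ 1 / 6)
    (hd2 : Real.exp (-(d * (κ / 2))) ≤ 1 / 2) :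
    J (1 / 2) 0 (ball x R \ B0 d) ≤ J (1 / 2) 0 (ball x R ∩ B0 d) := by
  have hκ0 : 0 < κ := by rw [hκ]; norm_num
  have hκ1 : κ ≤ 0.00001 := by rw [hκ]; norm_num
  have hd0 : (0 : ℝ) ≤ d := Nat.cast_nonneg d
  set I := J 1 x Set.univ with hI
  have hIt : I < ⊤ := J_univ_lt_top 1 one_pos x
  set E1 : Set (EuclideanSpace ℝ (Fin d)) := {y | (3 / 4 - κ / 8) * d ≤ ‖y - x‖ ^ 2} with hE1
  set E2 : Set (EuclideanSpace ℝ (Fin d)) := {y | ‖y - x‖ ^ 2 ≤ (3 / 4 - κ) * d} with hE2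
  set E3 : Set (EuclideanSpace ℝ (Fin d)) := {y | 0.75004 * d ≤ ‖y‖ ^ 2} with hE3
  set G : Set (EuclideanSpace ℝ (Fin d)) := (E1 ∪ (E2 ∪ E3))ᶜ with hG
  have mE1 : MeasurableSet E1 := measurableSet_le (by fun_prop) (by fun_prop)
  have mE2 : MeasurableSet E2 := measurableSet_le (by fun_prop) (by fun_prop)
  have mE3 : MeasurableSet E3 := measurableSet_le (by fun_prop) (by fun_prop)
  have mG : MeasurableSet G := (mE1.union (mE2.union mE3)).compl
  have small : ∀ u : ℝ, (κ / 8) ^ 2 ≤ u ^ 2 →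
      ENNReal.ofReal (Real.exp (-(d * u ^ 2 / 4))) * I ≤ ENNReal.ofReal (1 / 6) * I := by
    intro u hu
    gcongr
    refine le_trans (Real.exp_le_exp.mpr ?_) hd1
    have := mul_le_mul_of_nonneg_left hu hd0
    linarith
  have b1 : J 1 x E1 ≤ ENNReal.ofReal (1 / 6) * I := by
    have h := tail1 (d := d) q (3 / 4 - κ / 8) (by linarith) (by linarith) x hx
      (by rw [abs_le]; constructor <;> linarith)
    rw [hE1, J_reflect x (fun s => (3 / 4 - κ / 8) * d ≤ s)
      (measurableSet_le (by fun_prop) (by fun_prop)) mE1]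
    have hp : 0 < 3 / 4 - κ / 8 - (1 / 2 + q / 4) := by linarith
    refine (J_mono _ _ ?_).trans (h.trans (small _ ?_))
    · intro y hy
      exact mul_le_mul_of_nonneg_left hy hp.le
    · apply pow_le_pow_left₀ (by positivity); linarith
  have b2 : J 1 x E2 ≤ ENNReal.ofReal (1 / 6) * I := by
    have h := tail1 (d := d) q (3 / 4 - κ) (by linarith) (by linarith) x hx
      (by rw [abs_le]; constructor <;> linarith)
    rw [hE2, J_reflect x (fun s => s ≤ (3 / 4 - κ) * d)
      (measurableSet_le (by fun_prop) (by fun_prop)) mE2]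
    have hp : 3 / 4 - κ - (1 / 2 + q / 4) < 0 := by linarith
    refine (J_mono _ _ ?_).trans (h.trans (small _ ?_))
    · intro y hy
      exact mul_le_mul_of_nonpos_left hy hp.le
    · rw [← neg_sq (3 / 4 - κ - (1 / 2 + q / 4))]
      apply pow_le_pow_left₀ (by positivity); linarith
  have hε : (0.00004 : ℝ) ≤ 0.75004 - (1 / 2 + q / 4) := by norm_num; linarith
  have b3exp : J 1 x E3 ≤ ENNReal.ofReal (Real.exp (-(d * (0.75004 - (1 / 2 + q / 4)) ^ 2 / 4))) * I := by
    have h := tail1 (d := d) q 0.75004 (by linarith) (by linarith) x hx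
      (by rw [abs_le]; constructor <;> linarith)
    refine (J_mono _ _ ?_).trans h
    intro y hy
    have hy' : 0.75004 * (d : ℝ) ≤ ‖y‖ ^ 2 := hy
    have hp : 0 ≤ 0.75004 - (1 / 2 + q / 4) := le_trans (by norm_num) hε
    exact mul_le_mul_of_nonneg_left hy' hp
  have b3 : J 1 x E3 ≤ ENNReal.ofReal (1 / 6) * I := by
    refine b3exp.trans (small _ ?_)
    apply pow_le_pow_left₀ (by positivity); linarith
  have b3half : J 1 x E3 ≤ ENNReal.ofReal (Real.exp (-(d * (κ / 2))) * (1 / 2)) * I := by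
    refine b3exp.trans ?_
    gcongr
    refine le_trans (Real.exp_le_exp.mpr (?_ : _ ≤ -(d * (κ / 2)) + -(d * (κ / 2)))) ?_
    · have : (0.00004 : ℝ) ^ 2 ≤ (0.75004 - (1 / 2 + q / 4)) ^ 2 :=
        pow_le_pow_left₀ (by norm_num) hε 2
      have h2 : 4 * κ ≤ (0.75004 - (1 / 2 + q / 4)) ^ 2 := by
        refine le_trans ?_ this
        rw [hκ]; norm_num
      have := mul_le_mul_of_nonneg_left h2 hd0
      linarith
    · rw [Real.exp_add]
      exact mul_le_mul_of_nonneg_left hd2 (Real.exp_pos _).le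
  have hGI : ENNReal.ofReal (1 / 2) * I ≤ J 1 x G := by
    refine half_le (b := J 1 x (E1 ∪ (E2 ∪ E3))) hIt ?_ ?_
    · refine le_trans (J_mono _ _ ?_) (J_union _ _ _ _)
      rw [hG, Set.compl_union_self]
    · refine (J_union _ _ _ _).trans ((add_le_add b1 ((J_union _ _ _ _).trans (add_le_add b2 b3))).trans ?_)
      rw [← add_mul, ← add_mul, ← ENNReal.ofReal_add (by norm_num) (by norm_num),
        ← ENNReal.ofReal_add (by norm_num) (by norm_num)]
      norm_num
  have hGsub : G ⊆ ball x R ∩ B0 d := by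
    intro y hy
    simp only [hG, hE1, hE2, hE3, Set.mem_compl_iff, Set.mem_union, Set.mem_ofPred_eq, not_or, not_le] at hy
    refine ⟨?_, hy.2.2⟩
    rw [mem_ball, dist_eq_norm]
    exact lt_of_pow_lt_pow_left₀ 2 hR0 (hy.1.trans_le hR1)
  calc J (1 / 2) 0 (ball x R \ B0 d)
      ≤ ENNReal.ofReal (Real.exp ((3 / 4 * d - ‖x‖ ^ 2) / 2)) * J 1 x (ball x R \ B0 d) := by
        apply cmp1 x _ _ (measurableSet_ball.diff meas_B0)
        intro y hy
        have := hy.1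
        rw [mem_ball, dist_eq_norm] at this
        exact (pow_le_pow_left₀ (norm_nonneg _) this.le 2).trans hR2
    _ ≤ ENNReal.ofReal (Real.exp ((3 / 4 * d - ‖x‖ ^ 2) / 2)) *
          (ENNReal.ofReal (Real.exp (-(d * (κ / 2))) * (1 / 2)) * I) := by
        gcongr
        refine (J_mono _ _ ?_).trans b3half
        intro y hy
        exact not_lt.mp (show ¬ (‖y‖ ^ 2 < 0.75004 * (d : ℝ)) from hy.2)
    _ = ENNReal.ofReal (Real.exp (((3 / 4 - κ) * d - ‖x‖ ^ 2) / 2)) * (ENNReal.ofReal (1 / 2) * I) := by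
        rw [← mul_assoc, ← mul_assoc, ← ENNReal.ofReal_mul (by positivity),
          ← ENNReal.ofReal_mul (by positivity), ← mul_assoc, ← Real.exp_add]
        congr 4
        ring
    _ ≤ ENNReal.ofReal (Real.exp (((3 / 4 - κ) * d - ‖x‖ ^ 2) / 2)) * J 1 x G := by gcongr
    _ ≤ J (1 / 2) 0 G := by
        apply cmp2 x _ _ mG
        intro y hy
        simp only [hG, hE1, hE2, hE3, Set.mem_compl_iff, Set.mem_union, Set.mem_ofPred_eq, not_or, not_le] at hy
        exact hy.2.1.le
    _ ≤ _ := J_mono _ _ hGsub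

lemma annulus (κ : ℝ) (hκ : κ = 1 / 2500000000)
    (hd1 : Real.exp (-(d * (κ / 8) ^ 2 / 4)) ≤ 1 / 6) :
    ENNReal.ofReal ((1 - 2 * κ) ^ ((d : ℝ) / 2) * (1 / 2)) ≤
      stdGaussian d {x | (1 - 3 * κ) * d ≤ ‖x‖ ^ 2 ∧ ‖x‖ ^ 2 ≤ (1 - κ) * d} := by
  have hκ0 : 0 < κ := by rw [hκ]; norm_num
  have hκ1 : κ ≤ 0.00001 := by rw [hκ]; norm_num
  have hd0 : (0 : ℝ) ≤ d := Nat.cast_nonneg d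
  set q := 1 - 2 * κ with hq
  have hq0 : 0 < q := by linarith
  set A : Set (EuclideanSpace ℝ (Fin d)) :=
    {x | (1 - 3 * κ) * d ≤ ‖x‖ ^ 2 ∧ ‖x‖ ^ 2 ≤ (1 - κ) * d} with hA
  have mA : MeasurableSet A := by
    rw [hA, Set.ofPred_and]
    exact (measurableSet_le (by fun_prop) (by fun_prop)).inter
      (measurableSet_le (by fun_prop) (by fun_prop))
  set E1 : Set (EuclideanSpace ℝ (Fin d)) := {y | (1 - κ) * d ≤ ‖y‖ ^ 2} with hE1
  set E2 : Set (EuclideanSpace ℝ (Fin d)) := {y | ‖y‖ ^ 2 ≤ (1 - 3 * κ) * d} with hE2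
  set I := J (1 / (2 * q)) (0 : EuclideanSpace ℝ (Fin d)) Set.univ with hI
  have small : ENNReal.ofReal (Real.exp (-(d * κ ^ 2 / 8))) * I ≤ ENNReal.ofReal (1 / 6) * I := by
    gcongr
    refine le_trans (Real.exp_le_exp.mpr ?_) hd1
    have := mul_nonneg hd0 (sq_nonneg κ)
    linarith
  have b1 : J (1 / (2 * q)) 0 E1 ≤ ENNReal.ofReal (1 / 6) * I := by
    have h := tail2 (d := d) q (1 - κ) hq0 (by linarith)
      (by rw [abs_le]; constructor <;> linarith)
    have e : 1 - κ - q = κ := by rw [hq]; ring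
    rw [e] at h
    refine (J_mono _ _ ?_).trans (h.trans small)
    intro y hy
    exact mul_le_mul_of_nonneg_left hy hκ0.le
  have b2 : J (1 / (2 * q)) 0 E2 ≤ ENNReal.ofReal (1 / 6) * I := by
    have h := tail2 (d := d) q (1 - 3 * κ) hq0 (by linarith)
      (by rw [abs_le]; constructor <;> linarith)
    have e : 1 - 3 * κ - q = -κ := by rw [hq]; ring
    rw [e, neg_sq] at h
    refine (J_mono _ _ ?_).trans (h.trans small)
    intro y hy
    have hy' : ‖y‖ ^ 2 ≤ (1 - 3 * κ) * d := hy
    have hp : -κ ≤ 0 := by linarith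
    exact mul_le_mul_of_nonpos_left hy' hp
  have hAI : ENNReal.ofReal (1 / 2) * I ≤ J (1 / (2 * q)) 0 A := by
    refine half_le (b := J (1 / (2 * q)) 0 (E1 ∪ E2)) (J_univ_lt_top _ (by positivity) _) ?_ ?_
    · refine le_trans (J_mono _ _ ?_) (J_union _ _ _ _)
      intro y _
      simp only [hA, hE1, hE2, Set.mem_union, Set.mem_ofPred_eq]
      rcases le_total ((1 - κ) * d) (‖y‖ ^ 2) with h | h
      · exact Or.inr (Or.inl h)
      · rcases le_total (‖y‖ ^ 2) ((1 - 3 * κ) * d) with h' | h'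
        · exact Or.inr (Or.inr h')
        · exact Or.inl ⟨h', h⟩
    · refine (J_union _ _ _ _).trans ((add_le_add b1 b2).trans ?_)
      rw [← add_mul, ← ENNReal.ofReal_add (by norm_num) (by norm_num)]
      gcongr
      norm_num
  have hle : J (1 / (2 * q)) 0 A ≤ J (1 / 2) 0 A := by
    unfold J
    refine lintegral_mono fun y => ?_
    apply ENNReal.ofReal_le_ofReal
    apply Real.exp_le_exp.mpr
    have : 1 / 2 ≤ 1 / (2 * q) := by
      apply one_div_le_one_div_of_le (by positivity); linarith
    nlinarith [sq_nonneg ‖y‖]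
  rw [gam A mA]
  refine le_trans ?_ (mul_le_mul_right (hAI.trans hle) _)
  rw [hI, J, setLIntegral_univ, gauss_lint _ (by positivity), ← ENNReal.ofReal_mul (by norm_num),
    ← ENNReal.ofReal_mul (by positivity)]
  apply ENNReal.ofReal_le_ofReal
  apply le_of_eq
  have e2 : Real.pi / (1 / (2 * q)) = 2 * Real.pi * q := by field_simp
  rw [e2, Real.mul_rpow (by positivity) hq0.le, neg_div, Real.rpow_neg (by positivity)]
  have : (2 * Real.pi) ^ ((d : ℝ) / 2) ≠ 0 := by positivity
  simp only [norm_zero, ne_eq, OfNat.ofNat_ne_zero, not_false_eq_true, zero_pow, zero_div,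
    Real.exp_zero, mul_one]
  field_simp

lemma small_ball : stdGaussian d (B0 d) ≤
    ENNReal.ofReal ((3 / 4 * Real.exp (0.75004 / 3)) ^ ((d : ℝ) / 2)) := by
  rw [gam _ meas_B0]
  have h := chernoff (d := d) (1 / 2) (-(1 / 6)) (0.75004 * d) (by norm_num) 0
  have h2 : J (1 / 2) 0 (B0 d) ≤ _ := (J_mono _ _ (fun y hy => by
    have : ‖y‖ ^ 2 < 0.75004 * d := hy
    simp only [Set.mem_ofPred_eq]; linarith)).trans h
  refine (mul_le_mul_right h2 _).trans ?_
  rw [← ENNReal.ofReal_mul (by positivity)]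
  apply ENNReal.ofReal_le_ofReal
  apply le_of_eq
  have e2 : Real.pi / (1 / 2 - -(1 / 6)) = 2 * Real.pi * (3 / 4) := by ring
  rw [e2, Real.mul_rpow (x := 2 * Real.pi) (by positivity) (by norm_num), neg_div,
    Real.rpow_neg (by positivity),
    Real.mul_rpow (x := 3 / 4) (by norm_num) (by positivity), ← Real.exp_mul]
  have : (2 * Real.pi) ^ ((d : ℝ) / 2) ≠ 0 := by positivity
  simp only [norm_zero, ne_eq, OfNat.ofNat_ne_zero, not_false_eq_true, zero_pow, zero_div,
    Real.exp_zero, mul_one]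
  have e3 : -(-(1 / 6)) * (0.75004 * (d : ℝ)) = 0.75004 / 3 * (d / 2) := by ring
  rw [e3]
  field_simp

lemma base_lt : (1.019 : ℝ) ^ 2 * (3 / 4 * Real.exp (0.75004 / 3)) / (1 - 2 * (1 / 2500000000)) < 1 := by
  have h := Real.exp_bound' (x := 0.75004 / 3) (by norm_num) (by norm_num) (n := 8) (by norm_num)
  norm_num [Finset.sum_range_succ, Nat.factorial] at h ⊢
  linarith

end GW

/-- For every `p ∈ [1,∞)` and all sufficiently large `d`, the weak type `(p,p)` constant
of the averaging operator `A_{√(3d-3)/2}` for the standard Gaussian measure exceeds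
`1.019^{d/p}`: there exist a nonzero nonnegative `f ∈ L^p(γ^d)` and `α > 0` with
`α^p · γ^d({A f ≥ α}) > 1.019^d · ‖f‖_p^p`. -/
theorem stdGaussian_weak_type_constant_lower_bound (p : ℝ) (hp : 1 ≤ p) :
    ∃ D : ℕ, ∀ d : ℕ, D ≤ d →
      ∃ f : EuclideanSpace ℝ (Fin d) → ℝ≥0∞, Measurable f ∧
        0 < (∫⁻ x, f x ^ p ∂stdGaussian d) ∧ (∫⁻ x, f x ^ p ∂stdGaussian d) < ⊤ ∧
        ∃ α : ℝ, 0 < α ∧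
          ENNReal.ofReal ((1.019 : ℝ) ^ d) * (∫⁻ x, f x ^ p ∂stdGaussian d) <
            ENNReal.ofReal (α ^ p) *
              stdGaussian d
                {x | ENNReal.ofReal α ≤ gaussAvg d (Real.sqrt (3 * d - 3) / 2) f x} := by
  obtain ⟨κ, hκ⟩ : ∃ κ : ℝ, κ = 1 / 2500000000 := ⟨_, rfl⟩
  have hκ0 : 0 < κ := by rw [hκ]; norm_num
  have hκ1 : κ ≤ 0.00001 := by rw [hκ]; norm_num
  have hp0 : 0 < p := by linarith
  have hexp : ∀ c : ℝ, 0 < c → ∀ e : ℝ, 0 < e →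
      ∀ᶠ d : ℕ in Filter.atTop, Real.exp (-(d * c)) ≤ e := by
    intro c hc e he
    have h1 : Filter.Tendsto (fun d : ℕ => Real.exp (-((d : ℝ) * c))) Filter.atTop (nhds 0) :=
      Real.tendsto_exp_neg_atTop_nhds_zero.comp
        (tendsto_natCast_atTop_atTop.atTop_mul_const hc)
    exact h1.eventually_le_const he
  set β : ℝ := 1.019 ^ 2 * (3 / 4 * Real.exp (0.75004 / 3)) / (1 - 2 * κ) with hβ
  have hβ1 : β < 1 := by rw [hβ, hκ]; exact GW.base_lt
  have hq0 : 0 < 1 - 2 * κ := by linarith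
  have hβ0 : 0 < β := by positivity
  have ev3 : ∀ᶠ d : ℕ in Filter.atTop, β ^ ((d : ℝ) / 2) ≤ (1 / 2) ^ p * (1 / 2) / 2 := by
    have := hexp (-Real.log β / 2) (by have := Real.log_neg hβ0 hβ1; linarith)
      ((1 / 2) ^ p * (1 / 2) / 2) (by positivity)
    filter_upwards [this] with d hd
    rw [Real.rpow_def_of_pos hβ0]
    convert hd using 2
    ring
  have ev := (hexp ((κ / 8) ^ 2 / 4) (by positivity) (1 / 6) (by norm_num)).and
    ((hexp (κ / 2) (by positivity) (1 / 2) (by norm_num)).and (ev3.and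
      (Filter.eventually_ge_atTop (⌈6 / κ⌉₊ + 1))))
  obtain ⟨D, hD⟩ := Filter.eventually_atTop.mp ev
  refine ⟨D, fun d hd => ?_⟩
  obtain ⟨h1, h2, h3, h4⟩ := hD d hd
  rw [← mul_div_assoc] at h1
  have hd1 : (1 : ℝ) ≤ d := by exact_mod_cast (by omega : 1 ≤ d)
  have hd6 : 6 ≤ κ * d := by
    have : 6 / κ ≤ d := (Nat.le_ceil _).trans (by exact_mod_cast (by omega : ⌈6 / κ⌉₊ ≤ d))
    rw [div_le_iff₀ hκ0] at this
    linarith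
  have hf : ∀ x, ((GW.B0 d).indicator (fun _ => (1 : ℝ≥0∞)) x) ^ p =
      (GW.B0 d).indicator (fun _ => (1 : ℝ≥0∞)) x := by
    intro x
    by_cases hx : x ∈ GW.B0 d
    · simp [hx]
    · simp [hx, hp0]
  have hint : ∫⁻ x, ((GW.B0 d).indicator (fun _ => (1 : ℝ≥0∞)) x) ^ p ∂stdGaussian d =
      stdGaussian d (GW.B0 d) := by
    simp_rw [hf]
    rw [lintegral_indicator GW.meas_B0]; simp
  refine ⟨(GW.B0 d).indicator (fun _ => 1), measurable_const.indicator GW.meas_B0, ?_, ?_,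
    1 / 2, by norm_num, ?_⟩
  · rw [hint]
    exact GW.gam_pos _ (isOpen_lt (by fun_prop) (by fun_prop)) ⟨0, by
      show ‖(0 : EuclideanSpace ℝ (Fin d))‖ ^ 2 < 0.75004 * (d : ℝ)
      rw [norm_zero]; norm_num; linarith⟩
  · rw [hint]
    exact GW.small_ball.trans_lt ENNReal.ofReal_lt_top
  · rw [hint]
    have hsub : {x : EuclideanSpace ℝ (Fin d) | (1 - 3 * κ) * d ≤ ‖x‖ ^ 2 ∧ ‖x‖ ^ 2 ≤ (1 - κ) * d} ⊆
        {x | ENNReal.ofReal (1 / 2) ≤ gaussAvg d (Real.sqrt (3 * d - 3) / 2)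
          ((GW.B0 d).indicator (fun _ => 1)) x} := by
      intro x hx
      simp only [Set.mem_ofPred_eq] at hx ⊢
      set R := Real.sqrt (3 * d - 3) / 2 with hR
      have hRR : R ^ 2 = (3 * d - 3) / 4 := by
        rw [hR, div_pow, Real.sq_sqrt (by linarith)]; norm_num
      have hdp : (0 : ℝ) < d := by linarith
      have hmain := GW.main_ball κ hκ x (‖x‖ ^ 2 / d) R (by positivity) (by field_simp)
        (by rw [le_div_iff₀ hdp]; exact hx.1) (by rw [div_le_iff₀ hdp]; exact hx.2)
        (by rw [hRR]; linarith) (by rw [hRR]; linarith) h1 h2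
      have hg : stdGaussian d (ball x R \ GW.B0 d) ≤ stdGaussian d (ball x R ∩ GW.B0 d) := by
        rw [GW.gam _ (measurableSet_ball.diff GW.meas_B0),
          GW.gam _ (measurableSet_ball.inter GW.meas_B0)]
        gcongr
      have htop : stdGaussian d (ball x R) ≠ ⊤ := by
        rw [GW.gam _ measurableSet_ball]
        refine (ENNReal.mul_lt_top ENNReal.ofReal_lt_top ?_).ne
        exact (GW.J_mono _ _ (Set.subset_univ _)).trans_lt (GW.J_univ_lt_top _ (by norm_num) _)
      have hpos : stdGaussian d (ball x R) ≠ 0 := by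
        refine (GW.gam_pos _ isOpen_ball ⟨x, mem_ball_self ?_⟩).ne'
        rw [hR]
        have : (0 : ℝ) < 3 * d - 3 := by nlinarith
        positivity
      unfold gaussAvg
      rw [lintegral_indicator GW.meas_B0, Measure.restrict_restrict GW.meas_B0]
      simp only [lintegral_const, one_mul, Measure.restrict_apply_univ]
      rw [ENNReal.le_div_iff_mul_le (Or.inl hpos) (Or.inl htop), Set.inter_comm]
      have hs := measure_inter_add_sdiff (μ := stdGaussian d) (ball x R) GW.meas_B0
      rw [← hs]
      calc _ ≤ ENNReal.ofReal (1 / 2) * (stdGaussian d (ball x R ∩ GW.B0 d) +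
            stdGaussian d (ball x R ∩ GW.B0 d)) := by gcongr
        _ = stdGaussian d (ball x R ∩ GW.B0 d) := by
          rw [← two_mul, ← mul_assoc]
          have : ENNReal.ofReal (1 / 2) * 2 = 1 := by
            rw [← ENNReal.ofReal_ofNat, ← ENNReal.ofReal_mul (by norm_num)]; norm_num
          rw [this, one_mul]
    refine lt_of_lt_of_le ?_ (mul_le_mul_right ((GW.annulus κ hκ h1).trans (measure_mono hsub)) _)
    refine lt_of_le_of_lt (mul_le_mul_right GW.small_ball _) ?_
    rw [← ENNReal.ofReal_mul (by positivity), ← ENNReal.ofReal_mul (by positivity)]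
    rw [ENNReal.ofReal_lt_ofReal_iff (by positivity)]
    have e1 : (1.019 : ℝ) ^ d = (1.019 ^ 2) ^ ((d : ℝ) / 2) := by
      rw [← Real.rpow_natCast, ← Real.rpow_natCast, ← Real.rpow_mul (by norm_num)]
      congr 1
      push_cast
      ring
    have e2 : (1.019 ^ 2 : ℝ) * (3 / 4 * Real.exp (0.75004 / 3)) = β * (1 - 2 * κ) := by
      rw [hβ]; field_simp
    rw [e1, ← Real.mul_rpow (by positivity) (by positivity), e2, Real.mul_rpow hβ0.le hq0.le]
    have hX : 0 < (1 - 2 * κ) ^ ((d : ℝ) / 2) := by positivity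
    have hY : 0 < (1 / 2 : ℝ) ^ p := by positivity
    have hXY := mul_pos hX hY
    have := mul_le_mul_of_nonneg_right h3 hX.le
    nlinarith
end

section
/- Let d ≥ 1 and let μ be a Borel measure on ℝ^d, finite on balls, that is invariant under every orthogonal linear transformation of ℝ^d. Then for every r > 0 and every v ∈ ℝ^d with ‖v‖₂ = r, μ(B^cl(0,r)) ≤ 2^{d−1}·√(2πd)·μ(B^cl(v,r)). -/
open MeasureTheory Metric ENNReal

lemma aux_sameBall (d : ℕ)
    (μ : Measure (EuclideanSpace ℝ (Fin d)))
    (hrot : ∀ (T : EuclideanSpace ℝ (Fin d) ≃ₗᵢ[ℝ] EuclideanSpace ℝ (Fin d))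
      (s : Set (EuclideanSpace ℝ (Fin d))), μ (T '' s) = μ s)
    (r : ℝ) (v w : EuclideanSpace ℝ (Fin d)) (h : ‖v‖ = ‖w‖) :
    μ (closedBall w r) = μ (closedBall v r) := by
  have h1 := hrot ((Submodule.span ℝ {v - w})ᗮ.reflection) (closedBall v r)
  rw [LinearIsometryEquiv.image_closedBall, Submodule.reflection_sub h] at h1
  exact h1

lemma aux_mem (d : ℕ) (r : ℝ) (hr : 0 < r) (x e : EuclideanSpace ℝ (Fin d)) (he : ‖e‖ = 1)
    (hx : ‖x‖ ≤ r) (h : ‖x‖ / 2 ≤ inner ℝ x e) : x ∈ closedBall (r • e) r := by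
  rw [mem_closedBall, dist_eq_norm]
  refine abs_le_of_sq_le_sq' ?_ hr.le |>.2
  rw [norm_sub_sq_real, inner_smul_right, norm_smul, he, Real.norm_eq_abs, abs_of_pos hr]
  nlinarith [norm_nonneg x]

lemma aux_small (d : ℕ) (hd : d ≤ 2)
    (μ : Measure (EuclideanSpace ℝ (Fin d)))
    (hrot : ∀ (T : EuclideanSpace ℝ (Fin d) ≃ₗᵢ[ℝ] EuclideanSpace ℝ (Fin d))
      (s : Set (EuclideanSpace ℝ (Fin d))), μ (T '' s) = μ s)
    (r : ℝ) (hr : 0 < r) (v : EuclideanSpace ℝ (Fin d)) (hv : ‖v‖ = r) :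
    μ (closedBall 0 r) ≤ (2 * d : ℕ) * μ (closedBall v r) := by
  classical
  let b : Fin d → EuclideanSpace ℝ (Fin d) := fun i => EuclideanSpace.single i 1
  have hb : ∀ i, ‖b i‖ = 1 := fun i => by simp [b]
  have hsub : closedBall (0 : EuclideanSpace ℝ (Fin d)) r ⊆
      ⋃ i, (closedBall (r • b i) r ∪ closedBall (r • (- b i)) r) := by
    intro x hx
    rw [mem_closedBall_zero_iff] at hx
    have key : ∃ i, ‖x‖ / 2 ≤ |x i| := by
      by_contra! hcon
      have h2 : ‖x‖ ^ 2 = ∑ i, (x i) ^ 2 := by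
        rw [EuclideanSpace.norm_sq_eq]; simp
      have hpos : 0 < ‖x‖ := by
        rw [norm_pos_iff]
        rintro rfl
        have : Nonempty (Fin d) := by
          by_contra hne
          rw [not_nonempty_iff] at hne
          have : v = 0 := Subsingleton.elim _ _
          rw [this, norm_zero] at hv
          linarith
        obtain ⟨i⟩ := this
        have := hcon i
        simp at this
      have h3 : ∑ i, (x i) ^ 2 ≤ ∑ _i : Fin d, ‖x‖ ^ 2 / 4 := by
        refine Finset.sum_le_sum fun i _ => ?_
        have := hcon i
        rw [← sq_abs]
        nlinarith [abs_nonneg (x i)]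
      rw [← h2] at h3
      simp only [Finset.sum_const, Finset.card_univ, Fintype.card_fin, nsmul_eq_mul] at h3
      have : (d : ℝ) ≤ 2 := by exact_mod_cast hd
      nlinarith [pow_pos hpos 2]
    obtain ⟨i, hi⟩ := key
    refine Set.mem_iUnion.2 ⟨i, ?_⟩
    rcases le_abs.1 hi with h | h
    · left
      apply aux_mem d r hr x _ (hb i) hx
      simpa [b, EuclideanSpace.inner_single_right] using h
    · right
      apply aux_mem d r hr x _ (by rw [norm_neg, hb i]) hx
      simpa [b, EuclideanSpace.inner_single_right, inner_neg_right] using h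
  have hn : ∀ e : EuclideanSpace ℝ (Fin d), ‖e‖ = 1 →
      μ (closedBall (r • e) r) = μ (closedBall v r) := by
    intro e he
    apply aux_sameBall d μ hrot
    rw [hv, norm_smul, he, Real.norm_eq_abs, abs_of_pos hr, mul_one]
  calc μ (closedBall 0 r) ≤ _ := measure_mono hsub
    _ ≤ ∑ i, μ (closedBall (r • b i) r ∪ closedBall (r • (- b i)) r) :=
        measure_iUnion_fintype_le _ _
    _ ≤ ∑ _i : Fin d, (2 * μ (closedBall v r)) := by
        refine Finset.sum_le_sum fun i _ => (measure_union_le _ _).trans ?_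
        rw [hn _ (hb i), hn _ (by rw [norm_neg, hb i]), two_mul]
    _ = (2 * d : ℕ) * μ (closedBall v r) := by
        simp only [Finset.sum_const, Finset.card_univ, Fintype.card_fin, nsmul_eq_mul]
        push_cast
        ring

lemma aux_half (d : ℕ) (e : EuclideanSpace ℝ (Fin d)) (he : ‖e‖ = 1) :
    volume (closedBall (0 : EuclideanSpace ℝ (Fin d)) 1) ≤ 2 ^ (d + 1) *
      volume {y : EuclideanSpace ℝ (Fin d) | ‖y‖ ≤ 1 ∧ ‖y‖ / 2 ≤ inner ℝ e y} := by
  set H : Set (EuclideanSpace ℝ (Fin d)) :=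
    closedBall ((1/2 : ℝ) • e) (1/2) ∩ {y | 1/2 ≤ inner ℝ e y} with hH
  have hee : inner ℝ e e = 1 := by rw [real_inner_self_eq_norm_sq, he]; norm_num
  have hhe : ‖(1/2 : ℝ) • e‖ = 1/2 := by rw [norm_smul, he]; norm_num
  have hHs : H ⊆ {y | ‖y‖ ≤ 1 ∧ ‖y‖ / 2 ≤ inner ℝ e y} := by
    rintro y ⟨h1, h2⟩
    rw [mem_closedBall, dist_eq_norm] at h1
    have h2' : 1/2 ≤ inner ℝ e y := h2
    have : ‖y‖ ≤ 1 := by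
      have := norm_le_norm_add_norm_sub' y ((1/2 : ℝ) • e)
      linarith
    exact ⟨this, by linarith⟩
  have hmp : MeasurePreserving (fun y : EuclideanSpace ℝ (Fin d) => e - y) volume volume :=
    Measure.measurePreserving_sub_left volume e
  have hHm : MeasurableSet H := by
    apply IsClosed.measurableSet
    exact isClosed_closedBall.inter (isClosed_le continuous_const (by fun_prop))
  have hcov : closedBall ((1/2 : ℝ) • e) (1/2) ⊆ H ∪ (fun y => e - y) ⁻¹' H := by
    intro y hy
    by_cases h : 1/2 ≤ inner ℝ e y
    · exact Or.inl ⟨hy, h⟩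
    · right
      refine ⟨?_, ?_⟩
      · rw [mem_closedBall, dist_eq_norm] at hy ⊢
        have : e - y - (1/2 : ℝ) • e = -(y - (1/2 : ℝ) • e) := by module
        rw [this, norm_neg]; exact hy
      · show 1/2 ≤ inner ℝ e (e - y)
        rw [inner_sub_right, hee]
        linarith
  have h1 : volume (closedBall ((1/2 : ℝ) • e) (1/2)) ≤ 2 * volume H := by
    refine (measure_mono hcov).trans ((measure_union_le _ _).trans ?_)
    rw [hmp.measure_preimage hHm.nullMeasurableSet, two_mul]
  have h2 : volume (closedBall (0 : EuclideanSpace ℝ (Fin d)) 1) =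
      2 ^ d * volume (closedBall ((1/2 : ℝ) • e) (1/2)) := by
    rw [Measure.addHaar_closedBall _ _ (by norm_num), Measure.addHaar_closedBall _ _ (by norm_num),
      ← mul_assoc]
    congr 1
    have h3 : (2 : ℝ≥0∞) ^ d = ENNReal.ofReal (2 ^ d) := by
      rw [ENNReal.ofReal_pow (by norm_num)]; norm_num
    rw [h3, ← ENNReal.ofReal_mul (by positivity)]
    congr 1
    simp
  rw [h2, pow_succ, mul_assoc]
  gcongr
  exact h1.trans (by gcongr)

lemma aux_large (d : ℕ) (hd : 1 ≤ d)
    (μ : Measure (EuclideanSpace ℝ (Fin d)))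
    (hfin : ∀ (x : EuclideanSpace ℝ (Fin d)) (ρ : ℝ), μ (Metric.closedBall x ρ) < ⊤)
    (hrot : ∀ (T : EuclideanSpace ℝ (Fin d) ≃ₗᵢ[ℝ] EuclideanSpace ℝ (Fin d))
      (s : Set (EuclideanSpace ℝ (Fin d))), μ (T '' s) = μ s)
    (r : ℝ) (hr : 0 < r) (v : EuclideanSpace ℝ (Fin d)) (hv : ‖v‖ = r) :
    μ (closedBall 0 r) ≤ 2 ^ (d + 1) * μ (closedBall v r) := by
  have : Nonempty (Fin d) := ⟨⟨0, hd⟩⟩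
  have : Nontrivial (EuclideanSpace ℝ (Fin d)) :=
    ⟨v, 0, by rintro rfl; rw [norm_zero] at hv; linarith⟩
  set B : Set (EuclideanSpace ℝ (Fin d)) := closedBall 0 1 with hB
  have hunit : ∀ x : EuclideanSpace ℝ (Fin d), ∃ e : EuclideanSpace ℝ (Fin d),
      ‖e‖ = 1 ∧ x = ‖x‖ • e := by
    intro x
    by_cases hx : x = 0
    · refine ⟨r⁻¹ • v, ?_, by simp [hx]⟩
      rw [norm_smul, hv, Real.norm_eq_abs, abs_of_pos (inv_pos.2 hr), inv_mul_cancel₀ hr.ne']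
    · have := norm_pos_iff.2 hx
      refine ⟨‖x‖⁻¹ • x, ?_, ?_⟩
      · rw [norm_smul, norm_inv, norm_norm, inv_mul_cancel₀ this.ne']
      · rw [smul_smul, mul_inv_cancel₀ this.ne', one_smul]
  let ν := μ.restrict (closedBall 0 r)
  have hνfin : IsFiniteMeasure ν := ⟨by simpa [ν] using hfin 0 r⟩
  let S : Set (EuclideanSpace ℝ (Fin d) × EuclideanSpace ℝ (Fin d)) :=
    {p | ‖p.2‖ ≤ 1 ∧ ‖p.1‖ * ‖p.2‖ / 2 ≤ inner ℝ p.1 p.2}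
  have hS : MeasurableSet S := by
    apply IsClosed.measurableSet
    simp only [S, Set.ofPred_and]
    apply IsClosed.inter
    · apply isClosed_le <;> fun_prop
    · apply isClosed_le <;> fun_prop
  have hBfin : volume B ≠ ⊤ := measure_closedBall_lt_top.ne
  have hBpos : volume B ≠ 0 := (measure_closedBall_pos volume _ one_pos).ne'
  have hlow : volume B * μ (closedBall 0 r) ≤ 2 ^ (d + 1) * (ν.prod volume) S := by
    rw [Measure.prod_apply hS, ← lintegral_const_mul _ (measurable_measure_prodMk_left hS)]
    calc volume B * μ (closedBall 0 r) = ∫⁻ _x, volume B ∂ν := by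
          simp [ν]
      _ ≤ _ := by
          refine lintegral_mono fun x => ?_
          obtain ⟨e, he, hx⟩ := hunit x
          refine (aux_half d e he).trans ?_
          gcongr
          rintro y ⟨h1, h2⟩
          refine ⟨h1, ?_⟩
          show ‖x‖ * ‖y‖ / 2 ≤ inner ℝ x y
          have : inner ℝ x y = ‖x‖ * inner ℝ e y := by
            conv_lhs => rw [hx, real_inner_smul_left]
          rw [this]
          nlinarith [norm_nonneg x]
  have hup : (ν.prod volume) S ≤ volume B * μ (closedBall v r) := by
    rw [Measure.prod_apply_symm hS]
    calc _ ≤ ∫⁻ y, B.indicator (fun _ => μ (closedBall v r)) y := by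
          refine lintegral_mono_ae ?_
          have h0 : ∀ᵐ y : EuclideanSpace ℝ (Fin d), y ≠ 0 := by
            simp [ae_iff]
          filter_upwards [h0] with y hy
          by_cases hyB : y ∈ B
          · rw [Set.indicator_of_mem hyB]
            obtain ⟨e, he, hye⟩ := hunit y
            have hyp := norm_pos_iff.2 hy
            rw [← aux_sameBall d μ hrot r v (r • e)
              (by rw [hv, norm_smul, he, Real.norm_eq_abs, abs_of_pos hr, mul_one])]
            rw [Measure.restrict_apply (hS.preimage (by fun_prop))]
            refine measure_mono ?_
            rintro x ⟨⟨h1, h2⟩, h3⟩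
            rw [mem_closedBall_zero_iff] at h3
            refine aux_mem d r hr x e he h3 ?_
            have h2' : ‖x‖ * ‖y‖ / 2 ≤ inner ℝ x y := h2
            have : inner ℝ x y = ‖y‖ * inner ℝ x e := by
              conv_lhs => rw [hye, real_inner_smul_right]
            rw [this] at h2'
            refine le_of_mul_le_mul_left ?_ hyp
            linarith
          · have : (fun x => (x, y)) ⁻¹' S = ∅ := by
              ext x
              simp only [Set.mem_preimage, Set.mem_empty_iff_false, iff_false]
              rintro ⟨h1, -⟩
              exact hyB (mem_closedBall_zero_iff.2 h1)
            rw [this, measure_empty]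
            exact zero_le
      _ = volume B * μ (closedBall v r) := by
          rw [lintegral_indicator_const isClosed_closedBall.measurableSet, mul_comm]
  have hfinal : volume B * μ (closedBall 0 r) ≤
      volume B * (2 ^ (d + 1) * μ (closedBall v r)) := by
    refine hlow.trans ?_
    rw [mul_left_comm]
    gcongr
  exact (ENNReal.mul_le_mul_iff_right hBpos hBfin).1 hfinal

/-- For a rotationally invariant Borel measure `μ` on `ℝ^d` (finite on balls) and any
vector `v` with `‖v‖ = r`, one has `μ(B^cl(0,r)) ≤ 2^{d-1}√(2πd) · μ(B^cl(v,r))`. -/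
theorem rotationInvariant_closedBall_comparison (d : ℕ) (hd : 1 ≤ d)
    (μ : Measure (EuclideanSpace ℝ (Fin d)))
    (hfin : ∀ (x : EuclideanSpace ℝ (Fin d)) (ρ : ℝ), μ (Metric.closedBall x ρ) < ⊤)
    (hrot : ∀ (T : EuclideanSpace ℝ (Fin d) ≃ₗᵢ[ℝ] EuclideanSpace ℝ (Fin d))
      (s : Set (EuclideanSpace ℝ (Fin d))), μ (T '' s) = μ s)
    (r : ℝ) (hr : 0 < r) (v : EuclideanSpace ℝ (Fin d)) (hv : ‖v‖ = r) :
    μ (Metric.closedBall 0 r) ≤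
      ENNReal.ofReal (2 ^ (d - 1) * Real.sqrt (2 * Real.pi * d)) *
        μ (Metric.closedBall v r) := by
  have hpi := Real.pi_gt_three
  by_cases h2 : d ≤ 2
  · refine (aux_small d h2 μ hrot r hr v hv).trans ?_
    gcongr
    rw [← ENNReal.ofReal_natCast]
    apply ENNReal.ofReal_le_ofReal
    have h : (2 : ℝ) ≤ Real.sqrt (2 * Real.pi * d) := by
      apply Real.le_sqrt_of_sq_le
      have : (1 : ℝ) ≤ d := by exact_mod_cast hd
      nlinarith
    interval_cases d
    · simpa using h
    · push_cast at h ⊢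
      norm_num at h ⊢
      linarith
  · refine (aux_large d hd μ hfin hrot r hr v hv).trans ?_
    gcongr
    have h : (4 : ℝ) ≤ Real.sqrt (2 * Real.pi * d) := by
      apply Real.le_sqrt_of_sq_le
      have : (3 : ℝ) ≤ d := by exact_mod_cast (by omega : 3 ≤ d)
      nlinarith
    have h3 : (2 : ℝ≥0∞) ^ (d + 1) = ENNReal.ofReal (2 ^ (d + 1)) := by
      rw [ENNReal.ofReal_pow (by norm_num)]; norm_num
    rw [h3]
    apply ENNReal.ofReal_le_ofReal
    have h4 : (2 : ℝ) ^ (d + 1) = 2 ^ (d - 1) * 4 := by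
      obtain ⟨k, rfl⟩ : ∃ k, d = k + 1 := ⟨d - 1, by omega⟩
      simp only [Nat.add_sub_cancel]
      ring
    rw [h4]
    gcongr
end

section
/- Let d ≥ 1 and let μ be the measure on ℝ^d given by dμ(x) = f(x)dx, where f is locally integrable, radial and radially decreasing (f(x) = φ(‖x‖₂) for a nonincreasing function φ ≥ 0). Define the averaging operator with closed balls: A_r g(x) := (1/μ(B^cl(x,r))) ∫_{B^cl(x,r)} g dμ at points x with μ(B^cl(x,r)) > 0. Then for every r > 0 and every nonnegative g ∈ L¹(μ), ∫_{{x ∈ B(0,r) : μ(B^cl(x,r)) > 0}} A_r g dμ ≤ 2^{d−1}·√(2πd)·∫_{B(0,2r)} g dμ. -/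
open MeasureTheory Metric ENNReal

/-- Level-set comparison: for a radially decreasing `f = φ(‖·‖)`. -/
lemma level_set_comparison (d : ℕ) (φ : ℝ → ℝ) (hφ : AntitoneOn φ (Set.Ici 0))
    (r : ℝ) (x : EuclideanSpace ℝ (Fin d)) (hx : ‖x‖ < r) (t : ℝ) :
    volume ({z : EuclideanSpace ℝ (Fin d) | t < φ ‖z‖} ∩ ball 0 r) ≤
      2 ^ d * volume ({z : EuclideanSpace ℝ (Fin d) | t < φ ‖z‖} ∩ closedBall x r) := by
  set E := {z : EuclideanSpace ℝ (Fin d) | t < φ ‖z‖} ∩ ball 0 r with hE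
  rcases E.eq_empty_or_nonempty with h0 | hne
  · simp [h0]
  set s := sSup (norm '' E) with hs
  have hbd : BddAbove (norm '' E) := by
    refine ⟨r, ?_⟩
    rintro _ ⟨z, hz, rfl⟩
    have := hz.2
    simp at this
    exact this.le
  have hs0 : 0 ≤ s := Real.sSup_nonneg (by rintro _ ⟨z, hz, rfl⟩; exact norm_nonneg z)
  have hsr : s ≤ r := by
    refine csSup_le (hne.image _) ?_
    rintro _ ⟨z, hz, rfl⟩
    have := hz.2
    simp at this
    exact this.le
  have hsub1 : E ⊆ closedBall 0 s := by
    intro z hz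
    simpa using le_csSup hbd (Set.mem_image_of_mem norm hz)
  have hball : ∀ w : EuclideanSpace ℝ (Fin d), ‖w‖ < s → t < φ ‖w‖ := by
    intro w hw
    obtain ⟨_, ⟨z, hz, rfl⟩, hwz⟩ := exists_lt_of_lt_csSup (hne.image _) hw
    exact lt_of_lt_of_le hz.1 (hφ (norm_nonneg w) (norm_nonneg z) hwz.le)
  set e := ‖x‖⁻¹ • x with he
  have hxe : x = ‖x‖ • e := by
    by_cases h : x = 0
    · simp [h]
    · rw [he, smul_smul, mul_inv_cancel₀ (norm_ne_zero_iff.2 h), one_smul]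
  have hen : ‖e‖ ≤ 1 := by
    rw [he, norm_smul, norm_inv, norm_norm]
    exact inv_mul_le_one
  have hsub2 : ball ((s/2) • e) (s/2) ⊆
      {z : EuclideanSpace ℝ (Fin d) | t < φ ‖z‖} ∩ closedBall x r := by
    intro w hw
    rw [mem_ball, dist_eq_norm] at hw
    constructor
    · apply hball
      have h1 : ‖w‖ ≤ ‖w - (s/2) • e‖ + ‖(s/2) • e‖ := by
        simpa using norm_add_le (w - (s/2) • e) ((s/2) • e)
      have h2 : ‖(s/2) • e‖ ≤ s/2 := by
        rw [norm_smul, Real.norm_of_nonneg (by positivity)]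
        exact mul_le_of_le_one_right (by positivity) hen
      linarith
    · rw [mem_closedBall, dist_eq_norm]
      have h1 : ‖w - x‖ ≤ ‖w - (s/2) • e‖ + ‖(s/2) • e - x‖ := by
        simpa using norm_add_le (w - (s/2) • e) ((s/2) • e - x)
      have h2 : ‖(s/2) • e - x‖ ≤ |s/2 - ‖x‖| := by
        have : (s/2) • e - x = (s/2 - ‖x‖) • e := by
          rw [sub_smul, ← hxe]
        rw [this, norm_smul, Real.norm_eq_abs]
        exact mul_le_of_le_one_right (abs_nonneg _) hen
      have h3 : |s/2 - ‖x‖| ≤ r - s/2 := by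
        rw [abs_le]
        constructor <;> linarith [norm_nonneg x]
      linarith
  rcases hs0.eq_or_lt with h0 | hpos
  · by_cases hd : d = 0
    · subst hd
      have : closedBall x r = Set.univ := by
        ext w; simp [Subsingleton.elim w x, (lt_of_le_of_lt (norm_nonneg x) hx).le]
      rw [this, Set.inter_univ, pow_zero, one_mul]
      exact measure_mono Set.inter_subset_left
    · have : Nonempty (Fin d) := ⟨⟨0, Nat.pos_of_ne_zero hd⟩⟩
      have : volume E ≤ 0 := by
        refine (measure_mono hsub1).trans ?_
        rw [← h0]
        simp
      exact this.trans zero_le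
  calc volume E ≤ volume (closedBall (0 : EuclideanSpace ℝ (Fin d)) s) := measure_mono hsub1
    _ = 2 ^ d * volume (ball ((s/2) • e) (s/2)) := by
      rw [Measure.addHaar_closedBall _ _ hs0, Measure.addHaar_ball_of_pos _ ((s/2) • e) (half_pos hpos),
        ← mul_assoc]
      congr 1
      have h2 : (2 : ℝ≥0∞) = ENNReal.ofReal 2 := by simp
      simp only [finrank_euclideanSpace, Fintype.card_fin]
      rw [h2, ← ENNReal.ofReal_pow (by norm_num), ← ENNReal.ofReal_mul (by positivity)]
      rw [← mul_pow]
      congr 2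
      ring
    _ ≤ _ := by gcongr

theorem radial_decreasing_averaging_central_bound (d : ℕ) (hd : 1 ≤ d)
    (φ : ℝ → ℝ) (hφ0 : ∀ t, 0 ≤ φ t) (hφ : AntitoneOn φ (Set.Ici 0))
    (hloc : LocallyIntegrable (fun x : EuclideanSpace ℝ (Fin d) => φ ‖x‖) volume)
    (μ : Measure (EuclideanSpace ℝ (Fin d)))
    (hμ : μ = volume.withDensity fun x => ENNReal.ofReal (φ ‖x‖))
    (r : ℝ) (hr : 0 < r)
    (g : EuclideanSpace ℝ (Fin d) → ℝ≥0∞) (hg : Measurable g)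
    (hg1 : (∫⁻ x, g x ∂μ) < ⊤) :
    (∫⁻ x in {x | x ∈ Metric.ball (0 : EuclideanSpace ℝ (Fin d)) r ∧
        0 < μ (Metric.closedBall x r)},
        (∫⁻ y in Metric.closedBall x r, g y ∂μ) / μ (Metric.closedBall x r) ∂μ) ≤
      ENNReal.ofReal (2 ^ (d - 1) * Real.sqrt (2 * Real.pi * d)) *
        ∫⁻ x in Metric.ball (0 : EuclideanSpace ℝ (Fin d)) (2 * r), g x ∂μ := by
  have hae := hloc.aestronglyMeasurable.aemeasurable
  have hlayer : ∀ A : Set (EuclideanSpace ℝ (Fin d)), MeasurableSet A →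
      μ A = ∫⁻ t in Set.Ioi (0:ℝ), volume ({z : EuclideanSpace ℝ (Fin d) | t < φ ‖z‖} ∩ A) := by
    intro A hA
    rw [hμ, withDensity_apply _ hA, lintegral_eq_lintegral_meas_lt _
      (Filter.Eventually.of_forall fun z => hφ0 _) hae.restrict]
    simp only [Measure.restrict_apply' hA]
  have hcomp : ∀ x ∈ ball (0 : EuclideanSpace ℝ (Fin d)) r,
      μ (ball 0 r) ≤ 2 ^ d * μ (closedBall x r) := by
    intro x hx
    rw [hlayer _ measurableSet_ball, hlayer _ measurableSet_closedBall,
      ← lintegral_const_mul' _ _ (by simp)]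
    exact lintegral_mono fun t => level_set_comparison d φ hφ r x (by simpa using hx) t
  set M := μ (ball (0 : EuclideanSpace ℝ (Fin d)) r) with hM
  have hMtop : M ≠ ⊤ := by
    have h := hloc.integrableOn_isCompact (isCompact_closedBall (0 : EuclideanSpace ℝ (Fin d)) r)
    have h2 : μ (closedBall (0 : EuclideanSpace ℝ (Fin d)) r) < ⊤ := by
      rw [hμ, withDensity_apply _ measurableSet_closedBall]
      exact h.lintegral_lt_top
    exact ((measure_mono ball_subset_closedBall).trans_lt h2).ne
  set G := ∫⁻ x in Metric.ball (0 : EuclideanSpace ℝ (Fin d)) (2 * r), g x ∂μ with hG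
  set S := {x | x ∈ Metric.ball (0 : EuclideanSpace ℝ (Fin d)) r ∧
        0 < μ (Metric.closedBall x r)} with hS
  have hSM : μ S ≤ M := measure_mono fun x hx => hx.1
  have hconst : (2 : ℝ≥0∞) ^ d ≤ ENNReal.ofReal (2 ^ (d - 1) * Real.sqrt (2 * Real.pi * d)) := by
    have h2 : (2 : ℝ≥0∞) = ENNReal.ofReal 2 := by simp
    rw [h2, ← ENNReal.ofReal_pow (by norm_num)]
    apply ENNReal.ofReal_le_ofReal
    have h3 : (2:ℝ) ≤ Real.sqrt (2 * Real.pi * d) := by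
      apply Real.le_sqrt_of_sq_le
      have : (1:ℝ) ≤ d := by exact_mod_cast hd
      nlinarith [Real.pi_gt_three]
    obtain ⟨k, rfl⟩ : ∃ k, d = k + 1 := ⟨d - 1, by omega⟩
    rw [Nat.add_sub_cancel, pow_succ]
    gcongr
  refine le_trans ?_ (mul_le_mul_left hconst G)
  by_cases hM0 : M = 0
  · have : μ S = 0 := le_antisymm (hSM.trans hM0.le) zero_le
    rw [Measure.restrict_eq_zero.2 this]
    simp
  have hpt : ∀ x ∈ S, (∫⁻ y in Metric.closedBall x r, g y ∂μ) / μ (Metric.closedBall x r)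
      ≤ 2 ^ d * G / M := by
    intro x hx
    have h1 : ∫⁻ y in Metric.closedBall x r, g y ∂μ ≤ G := by
      apply lintegral_mono_set
      intro y hy
      have hx1 := hx.1
      rw [mem_closedBall] at hy
      rw [mem_ball] at hx1 ⊢
      linarith [dist_triangle y x 0]
    have h2 := hcomp x hx.1
    calc _ ≤ G / μ (closedBall x r) := by gcongr
      _ = 2 ^ d * G / (2 ^ d * μ (closedBall x r)) :=
        (ENNReal.mul_div_mul_left _ _ (by simp) (by simp)).symm
      _ ≤ _ := by gcongr
  calc _ ≤ ∫⁻ x in S, 2 ^ d * G / M ∂μ := by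
        have hSle : ∀ᵐ x ∂μ.restrict S, x ∈ ball (0 : EuclideanSpace ℝ (Fin d)) r ∧
            0 < μ (Metric.closedBall x r) := by
          have hSeq : S = ball (0 : EuclideanSpace ℝ (Fin d)) r := by
            ext x
            refine ⟨fun h => h.1, fun h => ⟨h, ?_⟩⟩
            rw [pos_iff_ne_zero]
            intro h0
            have := hcomp x h
            rw [h0, mul_zero] at this
            exact hM0 (le_antisymm this zero_le)
          have hm : MeasurableSet S := hSeq ▸ measurableSet_ball
          exact ae_restrict_mem hm
        exact lintegral_mono_ae (hSle.mono fun x hx => hpt x hx)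
    _ = 2 ^ d * G / M * μ S := by simp
    _ ≤ 2 ^ d * G / M * M := by gcongr
    _ ≤ _ := by rw [ENNReal.div_mul_cancel hM0 hMtop]
end

section
/- Let d ≥ 1 and let μ be the (non-normalized) Gaussian measure on ℝ^d with dμ(x) = e^{-‖x‖₂²/2} dx. Then for every r > 0 and every x ∈ ℝ^d with ‖x‖₂ ≥ r, μ(B(x,r)) ≥ (e^{-‖x‖₂²/2}·λ^d(B(0,r)) / √(π(d+1)))·(√3/2)^{d+1}, where λ^d denotes Lebesgue measure on ℝ^d. -/
open MeasureTheory Metric ENNReal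

lemma gamma_aux (a : ℝ) (ha : 1 ≤ a) :
    Real.sqrt (2 * a) * Real.Gamma a ≤ 2 * Real.Gamma (a + 1 / 2) := by
  have h := Real.Gamma_mul_add_mul_le_rpow_Gamma_mul_rpow_Gamma (s := a + 1 / 2)
    (t := a + 1 / 2 + 1) (a := 1 / 2) (b := 1 / 2) (by linarith) (by linarith)
    (by norm_num) (by norm_num) (by norm_num)
  have h0 : (1 / 2 : ℝ) * (a + 1 / 2) + 1 / 2 * (a + 1 / 2 + 1) = a + 1 := by ring
  have hG : 0 < Real.Gamma (a + 1 / 2) := Real.Gamma_pos_of_pos (by linarith)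
  have hG0 : 0 < Real.Gamma a := Real.Gamma_pos_of_pos (by linarith)
  rw [h0, Real.Gamma_add_one (by linarith), Real.Gamma_add_one (by linarith),
    ← Real.sqrt_eq_rpow, ← Real.sqrt_eq_rpow, ← Real.sqrt_mul hG.le] at h
  have h2 := (Real.le_sqrt' (by positivity)).1 h
  set G := Real.Gamma (a + 1 / 2)
  set G0 := Real.Gamma a
  rw [← abs_of_pos hG0, ← Real.sqrt_sq_eq_abs, ← Real.sqrt_mul (by linarith)]
  apply Real.sqrt_le_iff.2 ⟨by positivity, ?_⟩
  have h3 : (a + 1/2) * (2 * G) ^ 2 - (a + 1 / 2) * (2 * a * G0 ^ 2) ≥ 0 := by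
    have : a * G0 ^ 2 * (2 * a - 1) ≥ 0 := by
      apply mul_nonneg (by positivity); linarith
    nlinarith
  have h4 : (a + 1/2) * (2 * a * G0 ^ 2) ≤ (a + 1/2) * (2 * G) ^ 2 := by linarith
  exact le_of_mul_le_mul_left h4 (by linarith)

/-- The constant: volume of the unit ball. -/
noncomputable def kap (n : ℕ) : ℝ := Real.sqrt Real.pi ^ n / Real.Gamma (n / 2 + 1)

lemma kap_pos (n : ℕ) : 0 < kap n := by
  unfold kap
  have : 0 < Real.Gamma ((n : ℝ) / 2 + 1) := Real.Gamma_pos_of_pos (by positivity)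
  positivity

lemma vol_ball (n : ℕ) (x : EuclideanSpace ℝ (Fin n)) (r : ℝ) (hr : 0 < r) :
    volume (ball x r) = ENNReal.ofReal (r ^ n * kap n) := by
  rcases n with _ | n
  · have : ball x r = Set.univ := by
      ext y; simp [Subsingleton.elim y x, hr]
    rw [this, ← (EuclideanSpace.volume_preserving_symm_measurableEquiv_toLp (Fin 0)).symm.measure_preimage MeasurableSet.univ.nullMeasurableSet]
    simp [kap, volume_pi]
  · rw [EuclideanSpace.volume_ball, kap, ENNReal.ofReal_mul (by positivity),
      ENNReal.ofReal_pow hr.le]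
    simp

lemma kap_aux (n : ℕ) :
    kap (n + 1) / Real.sqrt (Real.pi * (((n + 1 : ℕ) : ℝ) + 1)) ≤ 2 * (kap n / (n + 2)) := by
  have h := gamma_aux ((n : ℝ) / 2 + 1) (by linarith [(Nat.cast_nonneg n : (0 : ℝ) ≤ n)])
  have e1 : 2 * ((n : ℝ) / 2 + 1) = n + 2 := by ring
  have e2 : (((n + 1 : ℕ) : ℝ)) / 2 + 1 = (n : ℝ) / 2 + 1 + 1 / 2 := by push_cast; ring
  have e3 : (((n + 1 : ℕ) : ℝ) + 1) = n + 2 := by push_cast; ring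
  have hG : 0 < Real.Gamma ((n : ℝ) / 2 + 1) := Real.Gamma_pos_of_pos (by positivity)
  have hG' : 0 < Real.Gamma ((n : ℝ) / 2 + 1 + 1 / 2) := Real.Gamma_pos_of_pos (by positivity)
  have hs : (n : ℝ) + 2 = Real.sqrt (n + 2) * Real.sqrt (n + 2) :=
    (Real.mul_self_sqrt (by positivity)).symm
  unfold kap
  rw [e1] at h
  rw [e2, e3, Real.sqrt_mul Real.pi_pos.le]
  have hp : 0 < Real.sqrt Real.pi := Real.sqrt_pos.2 Real.pi_pos
  have hn : 0 < Real.sqrt ((n : ℝ) + 2) := Real.sqrt_pos.2 (by positivity)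
  set G := Real.Gamma ((n : ℝ) / 2 + 1)
  set G' := Real.Gamma ((n : ℝ) / 2 + 1 + 1 / 2)
  set s := Real.sqrt ((n : ℝ) + 2)
  set p := Real.sqrt Real.pi
  rw [hs]
  have l : p ^ (n + 1) / G' / (p * s) = p ^ n / (G' * s) := by
    field_simp
    ring
  rw [l]
  have r : 2 * (p ^ n / G / (s * s)) = (p ^ n * 2) / (G * s * s) := by field_simp
  rw [r, div_le_div_iff₀ (by positivity) (by positivity)]
  have : p ^ n * s * (s * G) ≤ p ^ n * s * (2 * G') := by gcongr
  linarith

lemma int_aux (n : ℕ) (r : ℝ) (hr : 0 < r) :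
    ∫ t in (r / 2)..r, t / r * Real.sqrt (r ^ 2 - t ^ 2) ^ n =
      r ^ (n + 1) * (Real.sqrt 3 / 2) ^ (n + 2) / (n + 2) := by
  have hn : (n : ℝ) + 2 ≠ 0 := by positivity
  rw [intervalIntegral.integral_eq_sub_of_hasDerivAt_of_le
    (f := fun t => - (Real.sqrt (r ^ 2 - t ^ 2) ^ (n + 2) / (n + 2) / r)) (by linarith)]
  · have : r ^ 2 - (r / 2) ^ 2 = 3 * (r / 2) ^ 2 := by ring
    rw [this, Real.sqrt_mul (by norm_num), Real.sqrt_sq (by positivity)]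
    simp
    field_simp
    rw [show Real.sqrt 3 * r / 2 = r * (Real.sqrt 3 / 2) by ring, mul_pow]
    ring
  · fun_prop
  · intro t ht
    have hp : 0 < r ^ 2 - t ^ 2 := by nlinarith [ht.1, ht.2]
    have h1 : HasDerivAt (fun t : ℝ => r ^ 2 - t ^ 2) (-(2 * t)) t := by
      simpa using ((hasDerivAt_id t).pow 2).const_sub (r ^ 2)
    have h2 := ((((h1.sqrt hp.ne').pow (n + 2)).div_const ((n : ℝ) + 2)).div_const r).neg
    refine HasDerivAt.congr_deriv (f' := _) h2 ?_
    have hs := Real.sqrt_pos.2 hp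
    push_cast
    rw [pow_succ]
    field_simp
    try ring
  · apply Continuous.intervalIntegrable
    fun_prop

lemma cap_aux (n : ℕ) (r : ℝ) (hr : 0 < r) :
    ENNReal.ofReal (kap n * (r ^ (n + 1) * (Real.sqrt 3 / 2) ^ (n + 2) / (n + 2))) ≤
      volume {z : EuclideanSpace ℝ (Fin (n + 1)) | ‖z‖ < r ∧ r / 2 < z 0} := by
  have hm : MeasurableSet {z : EuclideanSpace ℝ (Fin (n + 1)) | ‖z‖ < r ∧ r / 2 < z 0} := by
    have a1 : MeasurableSet {z : EuclideanSpace ℝ (Fin (n + 1)) | ‖z‖ < r} :=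
      measurableSet_lt (by fun_prop) (by fun_prop)
    have a2 : MeasurableSet {z : EuclideanSpace ℝ (Fin (n + 1)) | r / 2 < z 0} :=
      measurableSet_lt (by fun_prop) (by fun_prop)
    exact a1.inter a2
  have mp := (PiLp.volume_preserving_toLp (Fin (n + 1))).comp
    (volume_preserving_piFinSuccAbove (fun _ : Fin (n + 1) => ℝ) 0).symm
  rw [← mp.measure_preimage hm.nullMeasurableSet, Measure.volume_eq_prod,
    Measure.prod_apply (mp.measurable hm), ← int_aux n r hr,
    ← intervalIntegral.integral_const_mul, intervalIntegral.integral_of_le (by linarith),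
    integral_Ioc_eq_integral_Ioo, ofReal_integral_eq_lintegral_ofReal]
  · rw [← lintegral_indicator measurableSet_Ioo]
    apply lintegral_mono
    intro t
    by_cases ht : t ∈ Set.Ioo (r / 2) r
    · rw [Set.indicator_of_mem ht]
      have hp : 0 < r ^ 2 - t ^ 2 := by nlinarith [ht.1, ht.2]
      have hs := Real.sqrt_pos.2 hp
      have hb := vol_ball n 0 _ hs
      rw [← (PiLp.volume_preserving_toLp (Fin n)).measure_preimage
        measurableSet_ball.nullMeasurableSet] at hb
      calc _ ≤ ENNReal.ofReal (Real.sqrt (r ^ 2 - t ^ 2) ^ n * kap n) := by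
            apply ENNReal.ofReal_le_ofReal
            have : t / r ≤ 1 := by rw [div_le_one hr]; exact ht.2.le
            have h2 : t / r * Real.sqrt (r ^ 2 - t ^ 2) ^ n ≤ 1 * Real.sqrt (r ^ 2 - t ^ 2) ^ n := by gcongr
            nlinarith [kap_pos n]
        _ = _ := hb.symm
        _ ≤ _ := by
            apply measure_mono
            intro w hw
            simp only [Set.mem_preimage, mem_ball_zero_iff] at hw
            have hw2 := (Real.lt_sqrt (norm_nonneg _)).1 hw
            rw [EuclideanSpace.norm_sq_eq] at hw2
            simp only [Set.mem_preimage, Set.mem_ofPred_eq]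
            constructor
            · apply lt_of_pow_lt_pow_left₀ 2 hr.le
              rw [EuclideanSpace.norm_sq_eq, Fin.sum_univ_succ]
              simp [MeasurableEquiv.piFinSuccAbove] at hw2 ⊢
              linarith
            · simpa [MeasurableEquiv.piFinSuccAbove] using ht.1
    · rw [Set.indicator_of_notMem ht]; exact bot_le
  · apply (Continuous.integrableOn_Icc (a := r / 2) (b := r) ?_).mono_set Set.Ioo_subset_Icc_self
    fun_prop
  · filter_upwards [ae_restrict_mem measurableSet_Ioo] with t ht
    have : 0 < t := by linarith [ht.1]
    have := kap_pos n
    simp only [Pi.zero_apply]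
    positivity

lemma cap_gen (n : ℕ) (r : ℝ) (u : EuclideanSpace ℝ (Fin (n + 1))) (hu : ‖u‖ = 1) :
    volume {z : EuclideanSpace ℝ (Fin (n + 1)) | ‖z‖ < r ∧ r / 2 < z 0} =
    volume {z : EuclideanSpace ℝ (Fin (n + 1)) | ‖z‖ < r ∧ r / 2 < inner ℝ u z} := by
  have hm : MeasurableSet {z : EuclideanSpace ℝ (Fin (n + 1)) | ‖z‖ < r ∧ r / 2 < z 0} := by
    have a1 : MeasurableSet {z : EuclideanSpace ℝ (Fin (n + 1)) | ‖z‖ < r} :=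
      measurableSet_lt (by fun_prop) (by fun_prop)
    have a2 : MeasurableSet {z : EuclideanSpace ℝ (Fin (n + 1)) | r / 2 < z 0} :=
      measurableSet_lt (by fun_prop) (by fun_prop)
    exact a1.inter a2
  set e : EuclideanSpace ℝ (Fin (n + 1)) := EuclideanSpace.single 0 1 with he
  have hue : ‖u‖ = ‖e‖ := by simp [he, hu]
  let A := Submodule.reflection (Submodule.span ℝ {u - e})ᗮ
  have hA : A u = e := Submodule.reflection_sub hue
  rw [← A.measurePreserving.measure_preimage hm.nullMeasurableSet]
  congr 1
  ext z
  have : (A z) 0 = inner ℝ u z := by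
    rw [← A.inner_map_map u z, hA, he]
    simp [EuclideanSpace.inner_single_left]
  simp [this]

theorem gaussian_ball_lower_bound (d : ℕ) (hd : 1 ≤ d) (r : ℝ) (hr : 0 < r)
    (x : EuclideanSpace ℝ (Fin d)) (hx : r ≤ ‖x‖) :
    ENNReal.ofReal
        (Real.exp (-‖x‖ ^ 2 / 2) *
          (volume (Metric.ball (0 : EuclideanSpace ℝ (Fin d)) r)).toReal /
            Real.sqrt (Real.pi * (d + 1)) * (Real.sqrt 3 / 2) ^ (d + 1)) ≤
      (volume.withDensity fun y : EuclideanSpace ℝ (Fin d) =>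
          ENNReal.ofReal (Real.exp (-‖y‖ ^ 2 / 2))) (Metric.ball x r) := by
  obtain ⟨n, rfl⟩ : ∃ n, d = n + 1 := ⟨d - 1, by omega⟩
  have hx0 : 0 < ‖x‖ := by linarith
  set R := ‖x‖ with hR
  set u : EuclideanSpace ℝ (Fin (n + 1)) := (-R⁻¹) • x with hu
  have hu1 : ‖u‖ = 1 := by
    rw [hu, norm_smul, ← hR]; simp [abs_of_pos hx0, hx0.ne']
  have hxu : x = (-R) • u := by
    rw [hu, smul_smul]; simp [hx0.ne']
  set C := {z : EuclideanSpace ℝ (Fin (n + 1)) | ‖z‖ < r ∧ r / 2 < inner ℝ u z} with hC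
  have hCm : MeasurableSet C := by
    have a1 : MeasurableSet {z : EuclideanSpace ℝ (Fin (n + 1)) | ‖z‖ < r} :=
      measurableSet_lt (by fun_prop) (by fun_prop)
    have a2 : MeasurableSet {z : EuclideanSpace ℝ (Fin (n + 1)) | r / 2 < inner ℝ u z} :=
      measurableSet_lt (by fun_prop) (by fun_prop)
    exact a1.inter a2
  have hC1 := cap_aux n r hr
  rw [cap_gen n r u hu1, ← hC] at hC1
  -- two copies of the cap
  let C1 := (fun y => y - x) ⁻¹' C
  let C2 := (fun y => (r • u + x) - y) ⁻¹' C
  have hv1 : volume C1 = volume C :=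
    (measurePreserving_sub_right volume x).measure_preimage hCm.nullMeasurableSet
  have hv2 : volume C2 = volume C :=
    (Measure.measurePreserving_sub_left volume (r • u + x)).measure_preimage hCm.nullMeasurableSet
  have hm2 : MeasurableSet C2 := (by fun_prop : Measurable (fun y => (r • u + x) - y)) hCm
  have huu : inner ℝ u u = (1 : ℝ) := by rw [real_inner_self_eq_norm_sq, hu1]; norm_num
  have hdisj : Disjoint C1 C2 := by
    rw [Set.disjoint_left]
    rintro y ⟨-, h1⟩ ⟨-, h2⟩
    have e : r • u + x - y = r • u - (y - x) := by abel
    simp only [e, inner_sub_right u (r • u), inner_smul_right, huu] at h1 h2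
    linarith
  -- geometry in terms of z = y - x
  have key : ∀ z : EuclideanSpace ℝ (Fin (n + 1)), ‖z‖ < r → ‖r • u - z‖ < r ∨ r / 2 < inner ℝ u z → 
      0 ≤ inner ℝ u z → ‖z + x‖ ≤ R := by
    intro z hz h h0
    have h1 : ‖z‖ ^ 2 ≤ 2 * r * inner ℝ u z := by
      rcases h with h | h
      · have := norm_sub_sq_real (r • u) z
        rw [norm_smul, hu1, inner_smul_left] at this
        simp [abs_of_pos hr] at this
        nlinarith [norm_nonneg (r • u - z)]
      · nlinarith [norm_nonneg z]
    have h2 := norm_add_sq_real z x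
    have h3 : inner ℝ z x = - R * inner ℝ u z := by
      conv_lhs => rw [hxu]
      rw [inner_smul_right, real_inner_comm]
    rw [h3, ← hR] at h2
    apply le_of_sq_le_sq _ hx0.le
    nlinarith
  have hsub1 : ∀ y ∈ C1, ‖y - x‖ < r ∧ ‖y‖ ≤ R := by
    rintro y ⟨h1, h2⟩
    refine ⟨h1, ?_⟩
    have := key (y - x) h1 (Or.inr h2) (by dsimp only at h2; linarith)
    simpa using this
  have hsub2 : ∀ y ∈ C2, ‖y - x‖ < r ∧ ‖y‖ ≤ R := by
    rintro y ⟨h1, h2⟩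
    have e : r • u + x - y = r • u - (y - x) := by abel
    simp only [e] at h1 h2
    have hcs : inner ℝ u (r • u - (y - x)) ≤ (r : ℝ) := by
      have := real_inner_le_norm u (r • u - (y - x))
      rw [hu1] at this; linarith
    have hlt : ‖y - x‖ < r := by
      have e2 : y - x = r • u - (r • u - (y - x)) := by abel
      set z := r • u - (y - x)
      rw [e2]
      have := norm_sub_sq_real (r • u) z
      rw [norm_smul, hu1, inner_smul_left] at this
      simp [abs_of_pos hr] at this
      apply lt_of_pow_lt_pow_left₀ 2 hr.le
      nlinarith [norm_nonneg z]
    refine ⟨hlt, ?_⟩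
    have := key (y - x) hlt (Or.inl h1) (by
      rw [inner_sub_right u (r • u), inner_smul_right, huu] at hcs; linarith)
    simpa using this
  have hsub : C1 ∪ C2 ⊆ ball x r := by
    rintro y (h | h)
    · rw [mem_ball_iff_norm]; exact (hsub1 y h).1
    · rw [mem_ball_iff_norm]; exact (hsub2 y h).1
  have hm12 : MeasurableSet (C1 ∪ C2) :=
    ((by fun_prop : Measurable (fun y => y - x)) hCm).union hm2
  have hvol : volume (C1 ∪ C2) = 2 * volume C := by
    rw [measure_union hdisj hm2, hv1, hv2, two_mul]
  calc _ ≤ ENNReal.ofReal (Real.exp (-R ^ 2 / 2)) * (2 * ENNReal.ofReal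
            (kap n * (r ^ (n + 1) * (Real.sqrt 3 / 2) ^ (n + 2) / (n + 2)))) := by
        rw [vol_ball _ _ _ hr, ENNReal.toReal_ofReal (by have := kap_pos (n+1); positivity),
          show (2 : ℝ≥0∞) = ENNReal.ofReal 2 by simp, ← ENNReal.ofReal_mul (by norm_num),
          ← ENNReal.ofReal_mul (by positivity)]
        apply ENNReal.ofReal_le_ofReal
        have hk := kap_aux n
        calc _ = (Real.exp (-R ^ 2 / 2) * r ^ (n + 1) * (Real.sqrt 3 / 2) ^ (n + 2)) *
              (kap (n + 1) / Real.sqrt (Real.pi * (((n + 1 : ℕ) : ℝ) + 1))) := by ring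
          _ ≤ (Real.exp (-R ^ 2 / 2) * r ^ (n + 1) * (Real.sqrt 3 / 2) ^ (n + 2)) *
              (2 * (kap n / (n + 2))) := by gcongr
          _ = _ := by ring
    _ ≤ ENNReal.ofReal (Real.exp (-R ^ 2 / 2)) * volume (C1 ∪ C2) := by
        rw [hvol]; gcongr
    _ = ∫⁻ y in C1 ∪ C2, ENNReal.ofReal (Real.exp (-R ^ 2 / 2)) := by
        rw [setLIntegral_const]
    _ ≤ ∫⁻ y in C1 ∪ C2, ENNReal.ofReal (Real.exp (-‖y‖ ^ 2 / 2)) := by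
        apply setLIntegral_mono' hm12
        intro y hy
        have hyR : ‖y‖ ≤ R := by
          rcases hy with h | h
          · exact (hsub1 y h).2
          · exact (hsub2 y h).2
        apply ENNReal.ofReal_le_ofReal
        apply Real.exp_le_exp.2
        have : ‖y‖ ^ 2 ≤ R ^ 2 := by gcongr
        linarith
    _ ≤ ∫⁻ y in ball x r, ENNReal.ofReal (Real.exp (-‖y‖ ^ 2 / 2)) :=
        lintegral_mono_set hsub
    _ = _ := (withDensity_apply _ measurableSet_ball).symm
end

section
/- There exists a Borel measure ν on ℝ, finite on bounded intervals and with ν([x, x+1]) > 0 for every x ∈ ℝ, such that the right directional averaging operator A^r_{1,ν}, defined by A^r_{1,ν} f(x) := (1/ν([x, x+1])) ∫_{[x,x+1]} f dν, is unbounded on L¹(ν): for every c > 0 there exists a nonnegative f ∈ L¹(ν) with ∫ f dν > 0 and ∫ A^r_{1,ν} f dν > c·∫ f dν. (One such measure is dν(x) = (1_B(x) + e^{-x}) dx with B = ⋃_{n≥0} [2n, 2n+1).) -/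
open MeasureTheory Metric ENNReal

/-- The density `exp x * exp (- exp x)`. -/
noncomputable def gumbelDensity (x : ℝ) : ℝ≥0∞ :=
  ENNReal.ofReal (Real.exp x * Real.exp (-Real.exp x))

lemma gumbelDensity_measurable : Measurable gumbelDensity := by
  unfold gumbelDensity; fun_prop

lemma gumbel_Icc (a b : ℝ) (h : a ≤ b) :
    volume.withDensity gumbelDensity (Set.Icc a b)
      = ENNReal.ofReal (Real.exp (-Real.exp a) - Real.exp (-Real.exp b)) := by
  rw [withDensity_apply _ measurableSet_Icc]
  unfold gumbelDensity
  have hc : Continuous fun x : ℝ => Real.exp x * Real.exp (-Real.exp x) := by fun_prop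
  rw [← ofReal_integral_eq_lintegral_ofReal hc.continuousOn.integrableOn_Icc
    (Filter.Eventually.of_forall fun x => by positivity)]
  congr 1
  rw [integral_Icc_eq_integral_Ioc, ← intervalIntegral.integral_of_le h,
    intervalIntegral.integral_eq_sub_of_hasDerivAt (f := fun x => -Real.exp (-Real.exp x))
      _ (hc.intervalIntegrable _ _)]
  · ring
  · intro x _
    have := ((Real.hasDerivAt_exp x).neg.exp).neg
    convert this using 1
    · rfl
    · simp only [Pi.neg_apply]
      ring

/-- There is a Borel measure `ν` on `ℝ`, finite on bounded intervals and giving positive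
mass to every interval `[x, x+1]`, such that the right directional averaging operator
`A^r_{1,ν} f (x) = (1 / ν([x, x+1])) ∫_{[x, x+1]} f dν` is unbounded on `L¹(ν)`. -/
theorem exists_measure_right_averaging_unbounded :
    ∃ ν : Measure ℝ,
      (∀ a b : ℝ, ν (Set.Icc a b) < ⊤) ∧
      (∀ x : ℝ, 0 < ν (Set.Icc x (x + 1))) ∧
      ∀ c : ℝ, 0 < c →
        ∃ f : ℝ → ℝ≥0∞, Measurable f ∧ 0 < (∫⁻ t, f t ∂ν) ∧ (∫⁻ t, f t ∂ν) < ⊤ ∧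
          ENNReal.ofReal c * (∫⁻ t, f t ∂ν) <
            ∫⁻ x, (∫⁻ t in Set.Icc x (x + 1), f t ∂ν) / ν (Set.Icc x (x + 1)) ∂ν := by
  have hpos : ∀ a b : ℝ, a < b → 0 < volume.withDensity gumbelDensity (Set.Icc a b) := by
    intro a b h
    rw [gumbel_Icc a b h.le, ENNReal.ofReal_pos, sub_pos, Real.exp_lt_exp, neg_lt_neg_iff,
      Real.exp_lt_exp]
    exact h
  have hfin : ∀ a b : ℝ, volume.withDensity gumbelDensity (Set.Icc a b) < ⊤ := by
    intro a b
    rcases le_or_gt a b with h | h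
    · rw [gumbel_Icc a b h]; exact ENNReal.ofReal_lt_top
    · rw [Set.Icc_eq_empty (not_le.mpr h)]; simp
  refine ⟨volume.withDensity gumbelDensity, hfin, fun x => hpos _ _ (by linarith), ?_⟩
  intro c hc
  obtain ⟨S, hS⟩ : ∃ S : ℝ, 2 * c < Real.exp S :=
    ⟨Real.log (2 * c + 1), by rw [Real.exp_log (by linarith)]; linarith⟩
  set ν := volume.withDensity gumbelDensity with hν
  set J := Set.Icc (S + 1 / 2) (S + 1) with hJ
  have hJm : MeasurableSet J := measurableSet_Icc
  have hJ0 : 0 < ν J := hpos _ _ (by linarith)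
  have hJt : ν J < ⊤ := hfin _ _
  refine ⟨J.indicator 1, measurable_one.indicator hJm, ?_⟩
  rw [lintegral_indicator_one hJm]
  refine ⟨hJ0, hJt, ?_⟩
  have key : ∀ x ∈ Set.Icc S (S + 1 / 2), ENNReal.ofReal (Real.exp S) * ν J ≤
      gumbelDensity x * ((∫⁻ t in Set.Icc x (x + 1), J.indicator 1 t ∂ν) /
        ν (Set.Icc x (x + 1))) := by
    intro x hx
    have h1 : ∫⁻ t in Set.Icc x (x + 1), J.indicator 1 t ∂ν = ν J := by
      rw [lintegral_indicator_one hJm, Measure.restrict_apply hJm, Set.inter_eq_left.mpr]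
      exact Set.Icc_subset_Icc hx.2 (by linarith [hx.1])
    have h2 : ν (Set.Icc x (x + 1)) ≤ ENNReal.ofReal (Real.exp (-Real.exp x)) := by
      rw [hν, gumbel_Icc _ _ (by linarith)]
      exact ENNReal.ofReal_le_ofReal (by linarith [Real.exp_pos (-Real.exp (x + 1))])
    have h3 : ν (Set.Icc x (x + 1)) ≠ 0 := (hpos _ _ (by linarith)).ne'
    have h4 : ν (Set.Icc x (x + 1)) ≠ ⊤ := (hfin _ _).ne
    rw [h1, ← mul_div_assoc, ENNReal.le_div_iff_mul_le (Or.inl h3) (Or.inl h4)]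
    unfold gumbelDensity
    rw [ENNReal.ofReal_mul (Real.exp_pos x).le, mul_right_comm]
    gcongr
    exact hx.1
  calc ENNReal.ofReal c * ν J
      < ENNReal.ofReal (Real.exp S / 2) * ν J := by
        refine ENNReal.mul_lt_mul_left hJ0.ne' hJt.ne ?_
        rw [ENNReal.ofReal_lt_ofReal_iff (by positivity)]; linarith
    _ = ∫⁻ x in Set.Icc S (S + 1 / 2), ENNReal.ofReal (Real.exp S) * ν J := by
        rw [setLIntegral_const, Real.volume_Icc, mul_right_comm,
          ← ENNReal.ofReal_mul (Real.exp_pos S).le]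
        congr 2; ring
    _ ≤ ∫⁻ x in Set.Icc S (S + 1 / 2), gumbelDensity x *
          ((∫⁻ t in Set.Icc x (x + 1), J.indicator 1 t ∂ν) / ν (Set.Icc x (x + 1))) :=
        setLIntegral_mono' measurableSet_Icc key
    _ ≤ ∫⁻ x, gumbelDensity x *
          ((∫⁻ t in Set.Icc x (x + 1), J.indicator 1 t ∂ν) / ν (Set.Icc x (x + 1))) :=
        setLIntegral_le_lintegral _ _
    _ = _ := by
        conv_rhs => rw [hν]
        rw [lintegral_withDensity_eq_lintegral_mul_non_measurable _ gumbelDensity_measurable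
          (Filter.Eventually.of_forall fun x => ENNReal.ofReal_lt_top)]
        rfl
end

section
/- Let (X,d) be a connected metric space with at least two points, and let μ be a nonzero τ-smooth Borel measure on X, finite on balls, satisfying a C local comparability condition. Then every open ball has strictly positive measure: μ(B(x,r)) > 0 for all x ∈ X and r > 0; and μ is continuous: μ({x}) = 0 for every x ∈ X. -/
open MeasureTheory Metric ENNReal

theorem chain_univ {X : Type*} [MetricSpace X] [ConnectedSpace X] (A : Set X) (hA : A.Nonempty)
    (r : ℝ) (hr : 0 < r) (h : ∀ y ∈ A, ∀ z, dist y z < r → z ∈ A) : A = Set.univ := by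
  apply IsClopen.eq_univ _ hA
  constructor
  · rw [← isOpen_compl_iff, Metric.isOpen_iff]
    intro z hz
    refine ⟨r, hr, fun y hy hyA => hz (h y hyA z ?_)⟩
    exact hy
  · rw [Metric.isOpen_iff]
    intro y hy
    refine ⟨r, hr, fun z hz => h y hy z ?_⟩
    rw [dist_comm]; exact hz

/-- On a connected metric space (with at least two points), a nonzero τ-smooth Borel
measure, finite on balls, satisfying a `C` local comparability condition gives positive
mass to every open ball and no mass to singletons. -/
theorem connected_locally_comparable_measure_properties
    {X : Type*} [MetricSpace X] [MeasurableSpace X] [BorelSpace X]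
    [ConnectedSpace X] [Nontrivial X]
    (μ : Measure X) (hμ : μ ≠ 0)
    (hfin : ∀ (x : X) (ρ : ℝ), μ (Metric.ball x ρ) < ⊤)
    (hτ : ∀ S : Set (Set X), (∀ U ∈ S, IsOpen U) →
      μ (⋃₀ S) = ⨆ (t : Finset (Set X)) (_ : ↑t ⊆ S), μ (⋃ U ∈ t, (U : Set X)))
    (C : ℝ) (hC : 1 ≤ C)
    (hcomp : ∀ (r : ℝ) (x y : X), dist x y < r →
      μ (Metric.ball x r) ≤ ENNReal.ofReal C * μ (Metric.ball y r)) :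
    (∀ (x : X) (r : ℝ), 0 < r → 0 < μ (Metric.ball x r)) ∧
    ∀ x : X, μ {x} = 0 := by
  constructor
  · intro x r hr
    rw [pos_iff_ne_zero]
    intro h0
    have hA := chain_univ {y : X | μ (Metric.ball y r) = 0} ⟨x, h0⟩ r hr (by
      intro y hy z hz
      have := hcomp r z y (by rwa [dist_comm])
      rw [Set.mem_setOf_eq] at hy
      rw [hy, mul_zero] at this
      exact le_antisymm this zero_le)
    have hall : ∀ y, μ (Metric.ball y r) = 0 := fun y => by
      have : y ∈ {y : X | μ (Metric.ball y r) = 0} := hA ▸ Set.mem_univ y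
      exact this
    have h1 := hτ (Set.range fun y => Metric.ball y r) (by
      rintro _ ⟨y, rfl⟩; exact Metric.isOpen_ball)
    have h2 : ⋃₀ (Set.range fun y : X => Metric.ball y r) = Set.univ := by
      apply Set.eq_univ_of_forall
      intro y
      exact ⟨_, ⟨y, rfl⟩, Metric.mem_ball_self hr⟩
    rw [h2] at h1
    apply hμ
    rw [← Measure.measure_univ_eq_zero, h1]
    simp only [ENNReal.iSup_eq_zero]
    intro t ht
    refine (measure_biUnion_null_iff t.countable_toSet).2 ?_
    intro U hU
    obtain ⟨y, rfl⟩ := ht hU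
    exact hall y
  · intro x
    obtain ⟨p, hp⟩ := exists_ne x
    have key : ∀ s : ℝ, 0 < s → s ≤ dist p x →
        μ {x} ≤ ENNReal.ofReal C * (ENNReal.ofReal C * μ (Metric.ball x (3 * s) \ {x})) := by
      intro s hs hsp
      have : ∃ y z, dist x y < s ∧ dist y z < s ∧ s ≤ dist z x := by
        by_contra hcon
        push Not at hcon
        have := chain_univ (Metric.ball x s) ⟨x, Metric.mem_ball_self hs⟩ s hs (by
          intro y hy z hz
          exact hcon y z (by rw [dist_comm]; exact hy) hz)
        have hpm : p ∈ Metric.ball x s := this ▸ Set.mem_univ p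
        rw [Metric.mem_ball] at hpm
        linarith
      obtain ⟨y, z, h1, h2, h3⟩ := this
      calc μ {x} ≤ μ (Metric.ball x s) :=
            measure_mono (Set.singleton_subset_iff.2 (Metric.mem_ball_self hs))
        _ ≤ ENNReal.ofReal C * μ (Metric.ball y s) := hcomp s x y h1
        _ ≤ ENNReal.ofReal C * (ENNReal.ofReal C * μ (Metric.ball z s)) := by
            gcongr; exact hcomp s y z h2
        _ ≤ _ := by
            gcongr
            intro w hw
            rw [Metric.mem_ball] at hw
            refine ⟨?_, ?_⟩
            · rw [Metric.mem_ball]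
              have := dist_triangle w z x
              have := dist_triangle z y x
              rw [dist_comm z y, dist_comm y x] at this
              linarith
            · rintro rfl
              rw [dist_comm] at hw
              linarith
    let D : ℕ → Set X := fun n => Metric.ball x (3 * (1 / ((n : ℝ) + 1))) \ {x}
    have hD : Filter.Tendsto (fun n => μ (D n)) Filter.atTop (nhds 0) := by
      have hI : ⋂ n, D n = ∅ := by
        rw [Set.eq_empty_iff_forall_notMem]
        intro w hw
        rw [Set.mem_iInter] at hw
        have hne : 0 < dist w x := dist_pos.2 (hw 0).2
        obtain ⟨n, hn⟩ := exists_nat_one_div_lt (show 0 < dist w x / 3 by positivity)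
        have := (hw n).1
        rw [Metric.mem_ball] at this
        linarith
      have := tendsto_measure_iInter_atTop (μ := μ) (s := D)
        (fun n => (Metric.isOpen_ball.measurableSet.diff
          (measurableSet_singleton x)).nullMeasurableSet)
        (by
          intro m n hmn
          apply Set.diff_subset_diff_left
          apply Metric.ball_subset_ball
          have := Nat.one_div_le_one_div (α := ℝ) hmn
          linarith)
        ⟨0, ((measure_mono Set.diff_subset).trans_lt (hfin x _)).ne⟩
      rw [hI, measure_empty] at this
      exact this
    have hlim : Filter.Tendsto (fun n => ENNReal.ofReal C * (ENNReal.ofReal C * μ (D n)))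
        Filter.atTop (nhds 0) := by
      have := ENNReal.Tendsto.const_mul (a := ENNReal.ofReal C)
        (ENNReal.Tendsto.const_mul (a := ENNReal.ofReal C) hD (Or.inr ENNReal.ofReal_ne_top))
        (Or.inr ENNReal.ofReal_ne_top)
      simpa using this
    refine le_antisymm (ge_of_tendsto hlim ?_) zero_le
    obtain ⟨N, hN⟩ := exists_nat_one_div_lt (dist_pos.2 hp)
    filter_upwards [Filter.eventually_ge_atTop N] with n hn
    exact key _ Nat.one_div_pos_of_nat ((Nat.one_div_le_one_div hn).trans hN.le)
end

section
/- Let (X,d) be a D-geometrically doubling metric space and let μ be a Borel measure on X, finite on balls, satisfying a C local comparability condition (C = C_μ). Then for every x ∈ X and every r > 0: μ(Bl(x,r,r)) ≤ D·C³·μ(B(x,r)) and μ(Blu(x,r,r)) ≤ D²·C⁴·μ(B(x,r)). -/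
open MeasureTheory Metric ENNReal

/-- A metric space is `D`-geometrically doubling if every ball of radius `r` can be
covered by at most `D` balls of radius `r/2`. -/
def IsGeomDoubling (X : Type*) [PseudoMetricSpace X] (D : ℕ) : Prop :=
  ∀ (x : X) (r : ℝ), ∃ t : Finset X, t.card ≤ D ∧
    Metric.ball x r ⊆ ⋃ y ∈ t, Metric.ball y (r / 2)

/-- The `s`-blossom `Bl(x, r, s)` of the open ball `B(x, r)`. -/
def Bl {X : Type*} [PseudoMetricSpace X] (x : X) (r s : ℝ) : Set X :=
  ⋃ z ∈ Metric.ball x r, Metric.ball z s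

theorem cover_bound_aux {X : Type*} [MetricSpace X] [MeasurableSpace X]
    (μ : Measure X) (S : Set X) (t : Finset X) (N : ℕ) (ht : t.card ≤ N) (r : ℝ)
    (hS : S ⊆ ⋃ y ∈ t, Metric.ball y r) (M : ℝ≥0∞)
    (h : ∀ y : X, ∀ w ∈ S, dist y w < r → μ (Metric.ball y r) ≤ M) :
    μ S ≤ N * M := by
  classical
  have hsub : S ⊆ ⋃ y ∈ t, (Metric.ball y r ∩ S) := by
    intro w hw
    have h1 := hS hw
    simp only [Set.mem_iUnion] at h1 ⊢
    obtain ⟨y, hy, hwy⟩ := h1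
    exact ⟨y, hy, hwy, hw⟩
  calc μ S ≤ μ (⋃ y ∈ t, (Metric.ball y r ∩ S)) := measure_mono hsub
    _ ≤ ∑ y ∈ t, μ (Metric.ball y r ∩ S) := measure_biUnion_finset_le _ _
    _ ≤ ∑ _y ∈ t, M := by
        apply Finset.sum_le_sum
        intro y _
        rcases Set.eq_empty_or_nonempty (Metric.ball y r ∩ S) with he | ⟨w, hw, hwS⟩
        · simp [he]
        · exact (measure_mono Set.inter_subset_left).trans
            (h y w hwS (by rw [dist_comm]; exact hw))
    _ = t.card * M := by simp
    _ ≤ N * M := by gcongr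

/-- In a `D`-geometrically doubling space, a measure satisfying a `C` local
comparability condition has boundedly blossoming balls:
`μ(Bl(x,r,r)) ≤ D C³ μ(B(x,r))` and `μ(Blu(x,r,r)) ≤ D² C⁴ μ(B(x,r))`. -/
theorem blossom_bounds_of_local_comparability
    {X : Type*} [MetricSpace X] [MeasurableSpace X] [BorelSpace X]
    (μ : Measure X) (hfin : ∀ (x : X) (ρ : ℝ), μ (Metric.ball x ρ) < ⊤)
    (D : ℕ) (hD : IsGeomDoubling X D)
    (C : ℝ) (hC : 1 ≤ C)
    (hcomp : ∀ (ρ : ℝ) (x y : X), dist x y < ρ →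
      μ (Metric.ball x ρ) ≤ ENNReal.ofReal C * μ (Metric.ball y ρ))
    (x : X) (r : ℝ) (hr : 0 < r) :
    μ (Bl x r r) ≤ ENNReal.ofReal (D * C ^ 3) * μ (Metric.ball x r) ∧
    μ (Blu x r r) ≤ ENNReal.ofReal (D ^ 2 * C ^ 4) * μ (Metric.ball x r) := by
  have hC0 : 0 ≤ C := by linarith
  constructor
  · obtain ⟨t, ht, hcov⟩ := hD x (2 * r)
    rw [show 2 * r / 2 = r by ring] at hcov
    have hsub : Bl x r r ⊆ Metric.ball x (2 * r) := by
      intro w hw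
      simp only [Bl, Set.mem_iUnion, Metric.mem_ball] at hw ⊢
      obtain ⟨z, hz, hwz⟩ := hw
      linarith [dist_triangle w z x]
    have key := cover_bound_aux μ (Bl x r r) t D ht r (hsub.trans hcov)
      (ENNReal.ofReal C ^ 3 * μ (Metric.ball x r)) (by
        intro y w hw hyw
        simp only [Bl, Set.mem_iUnion, Metric.mem_ball] at hw
        obtain ⟨z, hz, hwz⟩ := hw
        calc μ (Metric.ball y r) ≤ ENNReal.ofReal C * μ (Metric.ball w r) := hcomp r y w hyw
          _ ≤ ENNReal.ofReal C * (ENNReal.ofReal C * μ (Metric.ball z r)) := by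
              gcongr; exact hcomp r w z hwz
          _ ≤ ENNReal.ofReal C * (ENNReal.ofReal C *
                (ENNReal.ofReal C * μ (Metric.ball x r))) := by
              gcongr; exact hcomp r z x hz
          _ = _ := by ring)
    rw [ENNReal.ofReal_mul (by positivity), ENNReal.ofReal_natCast, ENNReal.ofReal_pow hC0,
      mul_assoc]
    exact key
  · classical
    obtain ⟨t, ht, hcov⟩ := hD x (4 * r)
    choose f hf hfc using fun y : X => hD y (2 * r)
    have hcov2 : Metric.ball x (4 * r) ⊆ ⋃ y ∈ t.biUnion f, Metric.ball y r := by
      intro w hw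
      have h1 := hcov hw
      simp only [Set.mem_iUnion] at h1
      obtain ⟨y, hy, hwy⟩ := h1
      rw [show 4 * r / 2 = 2 * r by ring] at hwy
      have h2 := hfc y hwy
      rw [show 2 * r / 2 = r by ring] at h2
      simp only [Set.mem_iUnion] at h2 ⊢
      obtain ⟨u, hu, hwu⟩ := h2
      exact ⟨u, Finset.mem_biUnion.2 ⟨y, hy, hu⟩, hwu⟩
    have hcard : (t.biUnion f).card ≤ D ^ 2 := by
      calc (t.biUnion f).card ≤ t.card * D := Finset.card_biUnion_le_card_mul _ _ _ fun y _ => hf y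
        _ ≤ D * D := by gcongr
        _ = D ^ 2 := by ring
    have hsub : Blu x r r ⊆ Metric.ball x (4 * r) := by
      intro w hw
      simp only [Blu, Set.mem_iUnion, Metric.mem_ball] at hw ⊢
      obtain ⟨z, hz, v, hzv, hwv⟩ := hw
      have h1 := dist_triangle w v x
      have h2 := dist_triangle v z x
      rw [dist_comm v z] at h2
      linarith
    have key := cover_bound_aux μ (Blu x r r) (t.biUnion f) (D ^ 2) hcard r (hsub.trans hcov2)
      (ENNReal.ofReal C ^ 4 * μ (Metric.ball x r)) (by
        intro y w hw hyw
        simp only [Blu, Set.mem_iUnion, Metric.mem_ball] at hw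
        obtain ⟨z, hz, v, hzv, hwv⟩ := hw
        calc μ (Metric.ball y r) ≤ ENNReal.ofReal C * μ (Metric.ball w r) := hcomp r y w hyw
          _ ≤ ENNReal.ofReal C * (ENNReal.ofReal C * μ (Metric.ball v r)) := by
              gcongr; exact hcomp r w v hwv
          _ ≤ ENNReal.ofReal C * (ENNReal.ofReal C *
                (ENNReal.ofReal C * μ (Metric.ball z r))) := by
              gcongr; exact hcomp r v z (by rw [dist_comm]; exact hzv)
          _ ≤ ENNReal.ofReal C * (ENNReal.ofReal C *
                (ENNReal.ofReal C * (ENNReal.ofReal C * μ (Metric.ball x r)))) := by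
              gcongr; exact hcomp r z x hz
          _ = _ := by ring)
    rw [ENNReal.ofReal_mul (by positivity), ENNReal.ofReal_pow (by positivity),
      ENNReal.ofReal_natCast, ENNReal.ofReal_pow hC0, mul_assoc]
    push_cast at key
    exact key
end

section
/- Let (X,d) be a geometrically doubling metric space and μ a Borel measure on X, finite on balls. Then the following are equivalent: (a) there exists C ≥ 1 such that μ satisfies a C local comparability condition; (b) there exists K₁ ≥ 1 such that for every x ∈ X and r > 0, μ(Bl(x,r,r)) ≤ K₁·μ(B(x,r)); (c) there exists K₂ ≥ 1 such that for every x ∈ X and r > 0, μ(Blu(x,r,r)) ≤ K₂·μ(B(x,r)). -/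
open MeasureTheory Metric ENNReal

theorem blu_bound_aux {X : Type*} [MetricSpace X] [MeasurableSpace X]
    (μ : Measure X) (D : ℕ) (hD : IsGeomDoubling X D) (C : ℝ) (hC : 1 ≤ C)
    (h : ∀ (r : ℝ) (x y : X), dist x y < r →
        μ (Metric.ball x r) ≤ ENNReal.ofReal C * μ (Metric.ball y r)) :
    ∃ K₂ : ℝ, 1 ≤ K₂ ∧ ∀ (x : X) (r : ℝ), 0 < r →
        μ (Blu x r r) ≤ ENNReal.ofReal K₂ * μ (Metric.ball x r) := by
  classical
  have hC4 : 1 ≤ C ^ 4 := one_le_pow₀ hC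
  refine ⟨((D * D : ℕ) + 1 : ℝ) * C ^ 4, ?_, ?_⟩
  · have : (0 : ℝ) ≤ (D * D : ℕ) := Nat.cast_nonneg _
    nlinarith
  intro x r hr
  obtain ⟨t, htc, ht⟩ := hD x (3 * r)
  choose f hfc hf using fun y => hD y (3 * r / 2)
  set T := t.biUnion f with hT
  have hTc : T.card ≤ D * D :=
    (Finset.card_biUnion_le_card_mul t f D (fun y _ => hfc y)).trans
      (Nat.mul_le_mul_right D htc)
  set M := ENNReal.ofReal C ^ 4 * μ (ball x r) with hM
  set S := T.filter (fun c => μ (ball c r) ≤ M) with hS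
  have hSc : S.card ≤ D * D := (Finset.card_filter_le _ _).trans hTc
  have hsub : Blu x r r ⊆ ⋃ c ∈ S, ball c r := by
    intro w hw
    simp only [Blu, Set.mem_iUnion, mem_ball, exists_prop] at hw
    obtain ⟨z, hzx, y, hzy, hwy⟩ := hw
    have hwx : w ∈ ball x (3 * r) := by
      rw [mem_ball]
      have h1 := dist_triangle w y x
      have h2 := dist_triangle y z x
      rw [dist_comm y z] at h2
      linarith
    have h1 := ht hwx
    simp only [Set.mem_iUnion, exists_prop] at h1
    obtain ⟨u, hu, hwu⟩ := h1
    have h2 := hf u hwu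
    simp only [Set.mem_iUnion, exists_prop, mem_ball] at h2
    obtain ⟨c, hc, hwc⟩ := h2
    have hwc' : dist w c < r := by linarith
    simp only [Set.mem_iUnion, exists_prop, mem_ball]
    refine ⟨c, ?_, hwc'⟩
    rw [hS, Finset.mem_filter]
    refine ⟨Finset.mem_biUnion.2 ⟨u, hu, hc⟩, ?_⟩
    calc μ (ball c r) ≤ ENNReal.ofReal C * μ (ball w r) := h r c w (by rwa [dist_comm])
      _ ≤ ENNReal.ofReal C * (ENNReal.ofReal C * μ (ball y r)) := by
          gcongr; exact h r w y hwy
      _ ≤ ENNReal.ofReal C * (ENNReal.ofReal C * (ENNReal.ofReal C * μ (ball z r))) := by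
          gcongr; exact h r y z (by rwa [dist_comm])
      _ ≤ ENNReal.ofReal C * (ENNReal.ofReal C * (ENNReal.ofReal C *
            (ENNReal.ofReal C * μ (ball x r)))) := by
          gcongr; exact h r z x hzx
      _ = M := by rw [hM]; ring
  calc μ (Blu x r r) ≤ μ (⋃ c ∈ S, ball c r) := measure_mono hsub
    _ ≤ ∑ c ∈ S, μ (ball c r) := measure_biUnion_finset_le _ _
    _ ≤ S.card • M := Finset.sum_le_card_nsmul _ _ _ (fun c hc => (Finset.mem_filter.1 hc).2)
    _ = (S.card : ℝ≥0∞) * M := nsmul_eq_mul _ _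
    _ ≤ ENNReal.ofReal ((D * D : ℕ) + 1 : ℝ) * M := by
        gcongr
        rw [← ENNReal.ofReal_natCast]
        apply ENNReal.ofReal_le_ofReal
        have : (S.card : ℝ) ≤ (D * D : ℕ) := by exact_mod_cast hSc
        linarith
    _ = _ := by
        rw [hM, ← mul_assoc, ENNReal.ofReal_mul (by positivity),
          ENNReal.ofReal_pow (by linarith)]

theorem comp_of_bl_aux {X : Type*} [MetricSpace X] [MeasurableSpace X]
    (μ : Measure X) (K : ℝ)
    (h : ∀ (x : X) (r : ℝ), 0 < r →
        μ (Bl x r r) ≤ ENNReal.ofReal K * μ (Metric.ball x r))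
    (r : ℝ) (x y : X) (hxy : dist x y < r) :
    μ (Metric.ball x r) ≤ ENNReal.ofReal K * μ (Metric.ball y r) :=
  (measure_mono (Set.subset_biUnion_of_mem (u := fun z => ball z r)
    (show x ∈ ball y r from hxy))).trans (h y r (dist_nonneg.trans_lt hxy))

theorem bl_subset_blu_aux {X : Type*} [MetricSpace X] (x : X) (r : ℝ) (hr : 0 < r) :
    Bl x r r ⊆ Blu x r r := by
  intro w hw
  simp only [Bl, Blu, Set.mem_iUnion, exists_prop] at hw ⊢
  obtain ⟨z, hz, hw⟩ := hw
  exact ⟨z, hz, z, mem_ball_self hr, hw⟩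

/-- In a geometrically doubling metric space, for a Borel measure finite on balls the
following are equivalent: (a) a local comparability condition; (b) bounded blossoms;
(c) bounded uncentered blossoms. -/
theorem local_comparability_iff_bounded_blossoms
    {X : Type*} [MetricSpace X] [MeasurableSpace X] [BorelSpace X]
    (μ : Measure X) (hfin : ∀ (x : X) (ρ : ℝ), μ (Metric.ball x ρ) < ⊤)
    (D : ℕ) (hD : IsGeomDoubling X D) :
    ((∃ C : ℝ, 1 ≤ C ∧ ∀ (r : ℝ) (x y : X), dist x y < r →
        μ (Metric.ball x r) ≤ ENNReal.ofReal C * μ (Metric.ball y r)) ↔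
      (∃ K₁ : ℝ, 1 ≤ K₁ ∧ ∀ (x : X) (r : ℝ), 0 < r →
        μ (Bl x r r) ≤ ENNReal.ofReal K₁ * μ (Metric.ball x r))) ∧
    ((∃ K₁ : ℝ, 1 ≤ K₁ ∧ ∀ (x : X) (r : ℝ), 0 < r →
        μ (Bl x r r) ≤ ENNReal.ofReal K₁ * μ (Metric.ball x r)) ↔
      (∃ K₂ : ℝ, 1 ≤ K₂ ∧ ∀ (x : X) (r : ℝ), 0 < r →
        μ (Blu x r r) ≤ ENNReal.ofReal K₂ * μ (Metric.ball x r))) := by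
  refine ⟨⟨?_, ?_⟩, ⟨?_, ?_⟩⟩
  · rintro ⟨C, hC, h⟩
    obtain ⟨K, hK, h'⟩ := blu_bound_aux μ D hD C hC h
    exact ⟨K, hK, fun x r hr => (measure_mono (bl_subset_blu_aux x r hr)).trans (h' x r hr)⟩
  · rintro ⟨K, hK, h⟩
    exact ⟨K, hK, comp_of_bl_aux μ K h⟩
  · rintro ⟨K, hK, h⟩
    exact blu_bound_aux μ D hD K hK (comp_of_bl_aux μ K h)
  · rintro ⟨K, hK, h'⟩
    exact ⟨K, hK, fun x r hr => (measure_mono (bl_subset_blu_aux x r hr)).trans (h' x r hr)⟩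
end

section
/- Let (X,d) be a D-geometrically doubling metric space and μ a Borel measure on X, finite on balls, satisfying a C local comparability condition (C = C_μ). Suppose there exists an integer K ≥ 1 such that for all x, z ∈ X and all r > 0 with d(x,z) < 2r, there exists a chain of balls B(y₀,r), …, B(y_m,r) with y₀ = x, m ≤ K, z ∈ B(y_m,r), and B(y_j,r) ∩ B(y_{j+1},r) ≠ ∅ for j = 0, …, m−1. Then μ is doubling with constant D·C^{2K+3}: for every x ∈ X and r > 0, μ(B(x,2r)) ≤ D·C^{2K+3}·μ(B(x,r)). -/
open MeasureTheory Metric ENNReal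

/-- In a `D`-geometrically doubling space, if a measure satisfies a `C` local
comparability condition and any two points at distance `< 2r` can be joined by an
intersecting chain of at most `K + 1` balls of radius `r`, then the measure is doubling
with constant `D · C^{2K+3}`. -/
theorem doubling_of_local_comparability_and_chains
    {X : Type*} [MetricSpace X] [MeasurableSpace X] [BorelSpace X]
    (μ : Measure X) (hfin : ∀ (x : X) (ρ : ℝ), μ (Metric.ball x ρ) < ⊤)
    (D : ℕ) (hD : IsGeomDoubling X D)
    (C : ℝ) (hC : 1 ≤ C)
    (hcomp : ∀ (ρ : ℝ) (x y : X), dist x y < ρ →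
      μ (Metric.ball x ρ) ≤ ENNReal.ofReal C * μ (Metric.ball y ρ))
    (K : ℕ) (hK : 1 ≤ K)
    (hchain : ∀ (x z : X) (r : ℝ), 0 < r → dist x z < 2 * r →
      ∃ (m : ℕ) (y : ℕ → X), m ≤ K ∧ y 0 = x ∧ z ∈ Metric.ball (y m) r ∧
        ∀ j < m, (Metric.ball (y j) r ∩ Metric.ball (y (j + 1)) r).Nonempty)
    (x : X) (r : ℝ) (hr : 0 < r) :
    μ (Metric.ball x (2 * r)) ≤
      ENNReal.ofReal (D * C ^ (2 * K + 3)) * μ (Metric.ball x r) := by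
  have hc1 : (1 : ENNReal) ≤ ENNReal.ofReal C := by
    simpa using ENNReal.ofReal_le_ofReal hC
  set c := ENNReal.ofReal C with hc
  obtain ⟨t, htD, ht⟩ := hD x (2 * r)
  have h2 : 2 * r / 2 = r := by ring
  rw [h2] at ht
  have key : ∀ w ∈ t, μ (Metric.ball w r ∩ Metric.ball x (2 * r)) ≤
      c ^ (2 * K + 3) * μ (Metric.ball x r) := by
    intro w _
    rcases Set.eq_empty_or_nonempty (Metric.ball w r ∩ Metric.ball x (2 * r)) with h | ⟨z, hz1, hz2⟩
    · rw [h]; simp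
    obtain ⟨m, y, hm, hy0, hzm, hj⟩ := hchain x z r hr (by
      rw [dist_comm]; exact hz2)
    have step : ∀ j, j ≤ m → μ (Metric.ball (y j) r) ≤ c ^ (2 * j) * μ (Metric.ball x r) := by
      intro j
      induction j with
      | zero => intro _; simp [hy0]
      | succ j ih =>
        intro hjm
        obtain ⟨p, hp1, hp2⟩ := hj j (by omega)
        calc μ (Metric.ball (y (j + 1)) r) ≤ c * μ (Metric.ball p r) :=
              hcomp r _ _ (by rw [dist_comm]; exact hp2)
          _ ≤ c * (c * μ (Metric.ball (y j) r)) := by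
              gcongr; exact hcomp r _ _ hp1
          _ ≤ c * (c * (c ^ (2 * j) * μ (Metric.ball x r))) := by
              gcongr; exact ih (by omega)
          _ = c ^ (2 * (j + 1)) * μ (Metric.ball x r) := by ring
    calc μ (Metric.ball w r ∩ Metric.ball x (2 * r)) ≤ μ (Metric.ball w r) :=
          measure_mono Set.inter_subset_left
      _ ≤ c * μ (Metric.ball z r) := hcomp r _ _ (by rw [dist_comm]; exact hz1)
      _ ≤ c * (c * μ (Metric.ball (y m) r)) := by
          gcongr; exact hcomp r _ _ hzm
      _ ≤ c * (c * (c ^ (2 * m) * μ (Metric.ball x r))) := by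
          gcongr; exact step m le_rfl
      _ = c ^ (2 * m + 2) * μ (Metric.ball x r) := by ring
      _ ≤ c ^ (2 * K + 3) * μ (Metric.ball x r) := by
          gcongr ?_ * _
          exact pow_le_pow_right₀ hc1 (by omega)
  have hsub : Metric.ball x (2 * r) ⊆ ⋃ w ∈ t, (Metric.ball w r ∩ Metric.ball x (2 * r)) := by
    intro p hp
    have := ht hp
    simp only [Set.mem_iUnion, Set.mem_inter_iff, exists_prop] at this ⊢
    obtain ⟨w, hw, hpw⟩ := this
    exact ⟨w, hw, hpw, hp⟩
  have hconst : ENNReal.ofReal (D * C ^ (2 * K + 3)) = D * c ^ (2 * K + 3) := by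
    rw [ENNReal.ofReal_mul (by positivity), ENNReal.ofReal_pow (by linarith),
      ENNReal.ofReal_natCast]
  rw [hconst]
  calc μ (Metric.ball x (2 * r)) ≤ μ (⋃ w ∈ t, (Metric.ball w r ∩ Metric.ball x (2 * r))) :=
        measure_mono hsub
    _ ≤ ∑ w ∈ t, μ (Metric.ball w r ∩ Metric.ball x (2 * r)) := measure_biUnion_finset_le _ _
    _ ≤ ∑ _w ∈ t, c ^ (2 * K + 3) * μ (Metric.ball x r) := Finset.sum_le_sum key
    _ = t.card * (c ^ (2 * K + 3) * μ (Metric.ball x r)) := by simp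
    _ ≤ D * (c ^ (2 * K + 3) * μ (Metric.ball x r)) := by gcongr
    _ = D * c ^ (2 * K + 3) * μ (Metric.ball x r) := by ring
end

section
/- Let (X,d) be a geometrically doubling metric space and μ a Borel measure on X, finite on balls, satisfying a C local comparability condition. If, in addition, either every open ball of X is connected, or X is quasiconvex, or X has the approximate midpoint property, then μ is doubling: there exists C' ≥ 1 such that μ(B(x,2r)) ≤ C'·μ(B(x,r)) for every x ∈ X and r > 0. -/
open MeasureTheory Metric ENNReal

/-- A metric space is quasiconvex if there is `Q ≥ 1` such that any two points `x, y`
can be joined by a curve of length at most `Q · dist x y`. -/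
def IsQuasiconvex (X : Type*) [PseudoMetricSpace X] : Prop :=
  ∃ Q : ℝ, 1 ≤ Q ∧ ∀ x y : X, ∃ γ : ℝ → X, ContinuousOn γ (Set.Icc 0 1) ∧
    γ 0 = x ∧ γ 1 = y ∧ eVariationOn γ (Set.Icc 0 1) ≤ ENNReal.ofReal (Q * dist x y)

/-- A metric space has the approximate midpoint property if for every `ε > 0` and all
`x, y` there is `z` with `dist x z, dist z y < ε + dist x y / 2`. -/
def HasApproxMidpoints (X : Type*) [PseudoMetricSpace X] : Prop :=
  ∀ ε : ℝ, 0 < ε → ∀ x y : X, ∃ z : X,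
    dist x z < ε + dist x y / 2 ∧ dist z y < ε + dist x y / 2

lemma chain_bound {X : Type*} [PseudoMetricSpace X] (f : X → ℝ≥0∞) (K : ℝ≥0∞) (hK : 1 ≤ K)
    (r : ℝ) (hf : ∀ z w : X, dist z w < r → f w ≤ K * f z) (S : Set X) (hS : IsPreconnected S)
    (t : Finset X) (ht : S ⊆ ⋃ c ∈ t, Metric.ball c (r / 2)) (x : X) (hx : x ∈ S) :
    ∀ y ∈ S, f y ≤ K ^ (t.card + 1) * f x := by
  classical
  let A : ℕ → Set X := fun n => {z | z ∈ S ∧ f z ≤ K ^ n * f x}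
  have hmono : ∀ n z, z ∈ A n → z ∈ A (n + 1) := fun n z hz =>
    ⟨hz.1, hz.2.trans (by gcongr; omega)⟩
  have hmono2 : ∀ n m z, n ≤ m → z ∈ A n → z ∈ A m := fun n m z h hz =>
    ⟨hz.1, hz.2.trans (by gcongr)⟩
  have hstep : ∀ n z w, z ∈ A n → w ∈ S → dist z w < r → w ∈ A (n + 1) := by
    intro n z w hz hw h
    refine ⟨hw, (hf z w h).trans ?_⟩
    rw [pow_succ', mul_assoc]
    gcongr
    exact hz.2
  let T : ℕ → Finset X := fun n => t.filter fun c => (Metric.ball c (r / 2) ∩ A n).Nonempty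
  have hTmono : ∀ n, T n ⊆ T (n + 1) := by
    intro n c hc
    simp only [T, Finset.mem_filter] at hc ⊢
    obtain ⟨hc, z, hz, hz'⟩ := hc
    exact ⟨hc, z, hz, hmono n z hz'⟩
  have hin : ∀ n c z, c ∈ T n → z ∈ S → z ∈ Metric.ball c (r / 2) → z ∈ A (n + 1) := by
    intro n c z hc hz hzc
    simp only [T, Finset.mem_filter] at hc
    obtain ⟨hc, w, hw, hw'⟩ := hc
    refine hstep n w z hw' hz ?_
    rw [Metric.mem_ball] at hw hzc
    have := dist_triangle_right w z c
    linarith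
  have hx0 : ∀ n, x ∈ A n := fun n => hmono2 0 n x (Nat.zero_le _) ⟨hx, by simp⟩
  have key : ∀ n, T n = T (n + 1) → ∀ y ∈ S, y ∈ A (n + 1) := by
    intro n hn y hy
    by_contra hyA
    have h := hS (⋃ c ∈ T n, Metric.ball c (r / 2)) (⋃ c ∈ t \ T n, Metric.ball c (r / 2))
      (isOpen_biUnion fun _ _ => isOpen_ball) (isOpen_biUnion fun _ _ => isOpen_ball)
    have hcov : ∀ z ∈ S, (z ∈ ⋃ c ∈ T n, Metric.ball c (r / 2)) ∨
        z ∈ ⋃ c ∈ t \ T n, Metric.ball c (r / 2) := by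
      intro z hz
      have := ht hz
      simp only [Set.mem_iUnion] at this ⊢
      obtain ⟨c, hc, hzc⟩ := this
      by_cases hcT : c ∈ T n
      · exact Or.inl ⟨c, hcT, hzc⟩
      · exact Or.inr ⟨c, Finset.mem_sdiff.2 ⟨hc, hcT⟩, hzc⟩
    have hU : ∀ z ∈ S, (z ∈ ⋃ c ∈ T n, Metric.ball c (r / 2)) → z ∈ A (n + 1) := by
      intro z hz h
      simp only [Set.mem_iUnion] at h
      obtain ⟨c, hc, hzc⟩ := h
      exact hin n c z hc hz hzc
    have hV : ∀ z ∈ S, (z ∈ ⋃ c ∈ t \ T n, Metric.ball c (r / 2)) → z ∉ A (n + 1) := by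
      intro z hz h hA
      simp only [Set.mem_iUnion] at h
      obtain ⟨c, hc, hzc⟩ := h
      rw [Finset.mem_sdiff, hn] at hc
      exact hc.2 (Finset.mem_filter.2 ⟨hc.1, z, hzc, hA⟩)
    obtain ⟨z, hz, hz1, hz2⟩ := h hcov
      ⟨x, hx, (hcov x hx).resolve_right fun h => hV x hx h (hx0 _)⟩
      ⟨y, hy, (hcov y hy).resolve_left fun h => hyA (hU y hy h)⟩
    exact hV z hz hz2 (hU z hz hz1)
  have main : ∀ n, (∀ y ∈ S, y ∈ A n) ∨ n ≤ (T n).card := by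
    intro n
    induction n with
    | zero => right; simp
    | succ n ih =>
      rcases ih with h | h
      · left; exact fun y hy => hmono n y (h y hy)
      · by_cases hT : T n = T (n + 1)
        · left; exact key n hT
        · right
          have := Finset.card_lt_card ((hTmono n).ssubset_of_ne hT)
          omega
  intro y hy
  rcases main (t.card + 1) with h | h
  · exact (h y hy).2
  · have : (T (t.card + 1)).card ≤ t.card := Finset.card_filter_le _ _
    omega

lemma iter_cover {X : Type*} [PseudoMetricSpace X] (D : ℕ) (hD : IsGeomDoubling X D)
    (x : X) (r : ℝ) (k : ℕ) : ∃ t : Finset X, t.card ≤ D ^ k ∧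
      Metric.ball x r ⊆ ⋃ y ∈ t, Metric.ball y (r / 2 ^ k) := by
  classical
  induction k with
  | zero => exact ⟨{x}, by simp, by simp⟩
  | succ k ih =>
    obtain ⟨t, htc, ht⟩ := ih
    choose u huc hu using fun y => hD y (r / 2 ^ k)
    refine ⟨t.biUnion u, ?_, ?_⟩
    · rw [pow_succ]
      exact (Finset.card_biUnion_le_card_mul _ _ D fun y _ => huc y).trans
        (Nat.mul_le_mul_right _ htc)
    · intro z hz
      have h1 := ht hz
      simp only [Set.mem_iUnion] at h1
      obtain ⟨y, hy, hzy⟩ := h1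
      have h2 := hu y hzy
      simp only [Set.mem_iUnion] at h2
      obtain ⟨w, hw, hzw⟩ := h2
      simp only [Set.mem_iUnion]
      refine ⟨w, Finset.mem_biUnion.2 ⟨y, hy, hw⟩, ?_⟩
      rwa [pow_succ, ← div_div]

lemma bound_of_connecting {X : Type*} [PseudoMetricSpace X] (D : ℕ) (hD : IsGeomDoubling X D)
    (M : ℝ) (hM : 0 < M)
    (hcon : ∀ (r : ℝ) (x y : X), 0 < r → dist x y < 3 * r → ∃ S : Set X, IsPreconnected S ∧
      x ∈ S ∧ y ∈ S ∧ S ⊆ Metric.ball x (M * r)) :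
    ∃ N : ℕ, ∀ (K : ℝ≥0∞), 1 ≤ K → ∀ (r : ℝ), 0 < r → ∀ (f : X → ℝ≥0∞),
      (∀ z w : X, dist z w < r → f w ≤ K * f z) → ∀ x y, dist x y < 3 * r →
      f y ≤ K ^ N * f x := by
  obtain ⟨k, hk⟩ := pow_unbounded_of_one_lt (2 * M) (one_lt_two : (1 : ℝ) < 2)
  refine ⟨D ^ k + 1, fun K hK r hr f hf x y hxy => ?_⟩
  obtain ⟨S, hS, hxS, hyS, hSb⟩ := hcon r x y hr hxy
  obtain ⟨t, htc, ht⟩ := iter_cover D hD x (M * r) k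
  have hle : M * r / 2 ^ k ≤ r / 2 := by
    rw [div_le_div_iff₀ (by positivity) (by norm_num)]
    nlinarith
  refine (chain_bound f K hK r hf S hS t ?_ x hxS y hyS).trans ?_
  · exact (hSb.trans ht).trans (Set.iUnion₂_mono fun c _ => Metric.ball_subset_ball hle)
  · gcongr

lemma bound_all {X : Type*} [PseudoMetricSpace X] (D : ℕ) (hD : IsGeomDoubling X D)
    (hgeom : (∀ (x : X) (r : ℝ), IsPreconnected (Metric.ball x r)) ∨
      IsQuasiconvex X ∨ HasApproxMidpoints X) :
    ∃ N : ℕ, ∀ (K : ℝ≥0∞), 1 ≤ K → ∀ (r : ℝ), 0 < r → ∀ (f : X → ℝ≥0∞),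
      (∀ z w : X, dist z w < r → f w ≤ K * f z) → ∀ x y, dist x y < 3 * r →
      f y ≤ K ^ N * f x := by
  rcases hgeom with h | ⟨Q, hQ, h⟩ | h
  · refine bound_of_connecting D hD 3 (by norm_num) fun r x y hr hxy =>
      ⟨Metric.ball x (3 * r), h _ _, ?_, ?_, subset_rfl⟩
    · exact Metric.mem_ball_self (by positivity)
    · rwa [Metric.mem_ball']
  · refine bound_of_connecting D hD (3 * Q) (by linarith) fun r x y hr hxy => ?_
    obtain ⟨γ, hγ, h0, h1, hv⟩ := h x y
    refine ⟨γ '' Set.Icc 0 1, isPreconnected_Icc.image γ hγ, ⟨0, by simp, h0⟩,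
      ⟨1, by simp, h1⟩, ?_⟩
    rintro _ ⟨s, hs, rfl⟩
    have h2 := (eVariationOn.edist_le γ hs (show (0 : ℝ) ∈ Set.Icc 0 1 by simp)).trans hv
    rw [h0, edist_dist, ENNReal.ofReal_le_ofReal_iff (by positivity)] at h2
    rw [Metric.mem_ball]
    nlinarith
  · refine ⟨4, fun K hK r hr f hf x y hxy => ?_⟩
    have two : ∀ x y, dist x y < 2 * r → f y ≤ K * (K * f x) := by
      intro x y hxy
      obtain ⟨z, h1, h2⟩ := h (r - dist x y / 2) (by linarith) x y
      refine (hf z y (by linarith)).trans ?_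
      gcongr
      exact hf x z (by linarith)
    obtain ⟨z, h1, h2⟩ := h (2 * r - dist x y / 2) (by linarith) x y
    calc f y ≤ K * (K * f z) := two z y (by linarith)
      _ ≤ K * (K * (K * (K * f x))) := by gcongr; exact two x z (by linarith)
      _ = K ^ 4 * f x := by ring

/-- In a geometrically doubling metric space in which all balls are connected, or which
is quasiconvex, or which has the approximate midpoint property, every measure (finite on
balls) satisfying a `C` local comparability condition is doubling. -/
theorem doubling_of_local_comparability
    {X : Type*} [MetricSpace X] [MeasurableSpace X] [BorelSpace X]
    (μ : Measure X) (hfin : ∀ (x : X) (ρ : ℝ), μ (Metric.ball x ρ) < ⊤)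
    (D : ℕ) (hD : IsGeomDoubling X D)
    (C : ℝ) (hC : 1 ≤ C)
    (hcomp : ∀ (r : ℝ) (x y : X), dist x y < r →
      μ (Metric.ball x r) ≤ ENNReal.ofReal C * μ (Metric.ball y r))
    (hgeom : (∀ (x : X) (r : ℝ), IsPreconnected (Metric.ball x r)) ∨
      IsQuasiconvex X ∨ HasApproxMidpoints X) :
    ∃ C' : ℝ, 1 ≤ C' ∧ ∀ (x : X) (r : ℝ), 0 < r →
      μ (Metric.ball x (2 * r)) ≤ ENNReal.ofReal C' * μ (Metric.ball x r) := by
  classical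
  obtain ⟨N, hN⟩ := bound_all D hD hgeom
  have hC0 : 0 ≤ C := by linarith
  refine ⟨D * C ^ N + 1, le_add_of_nonneg_left (by positivity), fun x r hr => ?_⟩
  have hK : 1 ≤ ENNReal.ofReal C := by simpa using hC
  have hb := hN (ENNReal.ofReal C) hK r hr (fun z => μ (Metric.ball z r))
    (fun z w h => hcomp r w z (by rwa [dist_comm]))
  obtain ⟨t, htc, ht⟩ := hD x (2 * r)
  rw [mul_div_cancel_left₀ r two_ne_zero] at ht
  let u := t.filter fun y => dist x y < 3 * r
  have hu : Metric.ball x (2 * r) ⊆ ⋃ y ∈ u, Metric.ball y r := by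
    intro z hz
    have h1 := ht hz
    simp only [Set.mem_iUnion] at h1 ⊢
    obtain ⟨y, hy, hzy⟩ := h1
    refine ⟨y, Finset.mem_filter.2 ⟨hy, ?_⟩, hzy⟩
    rw [Metric.mem_ball] at hz hzy
    have := dist_triangle_left x y z
    linarith
  calc μ (Metric.ball x (2 * r)) ≤ μ (⋃ y ∈ u, Metric.ball y r) := measure_mono hu
    _ ≤ ∑ y ∈ u, μ (Metric.ball y r) := measure_biUnion_finset_le _ _
    _ ≤ ∑ y ∈ u, ENNReal.ofReal C ^ N * μ (Metric.ball x r) :=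
      Finset.sum_le_sum fun y hy => hb x y (Finset.mem_filter.1 hy).2
    _ = u.card * (ENNReal.ofReal C ^ N * μ (Metric.ball x r)) := by
      rw [Finset.sum_const, nsmul_eq_mul]
    _ ≤ D * (ENNReal.ofReal C ^ N * μ (Metric.ball x r)) := by
      gcongr
      exact (Finset.card_filter_le _ _).trans htc
    _ = ENNReal.ofReal (D * C ^ N) * μ (Metric.ball x r) := by
      rw [ENNReal.ofReal_mul (by positivity), ENNReal.ofReal_pow hC0, ENNReal.ofReal_natCast,
        mul_assoc]
    _ ≤ ENNReal.ofReal (D * C ^ N + 1) * μ (Metric.ball x r) := by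
      gcongr
      linarith
end
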